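/- arXiv:1311.0599 — 2 statements merged into one kernel-verified Lean document; each statement's English description precedes it below -/
import Mathlib

section
/- For any positive integers n, s and any odd positive integer m, the number of conjugacy classes of the special orthogonal group SO(2n) consisting of elements x with x^m = 1 and with exactly s distinct conjugate pairs of eigenvalues equals C(n-1, s-1) · ( C(⌊m/2⌋, s-1) + 2 · C(⌊m/2⌋, s) ). -/
open Matrix

/-- The special orthogonal group, as the subgroup of the orthogonal group
`Matrix.orthogonalGroup (Fin k) ℝ` consisting of the elements of determinant `1`. -/
noncomputable def SO (k : ℕ) : Subgroup (Matrix.orthogonalGroup (Fin k) ℝ) where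
  carrier := {x | (x : Matrix (Fin k) (Fin k) ℝ).det = 1}
  one_mem' := by simp
  mul_mem' := by
    intro a b ha hb
    simp only [Set.mem_setOf_eq, Matrix.UnitaryGroup.mul_val, Matrix.det_mul] at *
    rw [ha, hb, mul_one]
  inv_mem' := by
    intro a ha
    simp only [Set.mem_setOf_eq, Matrix.UnitaryGroup.inv_val, Matrix.star_eq_conjTranspose,
      Matrix.det_conjTranspose, star_trivial] at *
    exact ha

/-- Two semisimple endomorphisms over an algebraically closed field with the same characteristic
polynomial are conjugate. -/
theorem Module.End.IsSemisimple.exists_linearEquiv_of_charpoly_eq {K V : Type*} [Field K]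
    [IsAlgClosed K] [AddCommGroup V] [Module K V] [FiniteDimensional K V] {f g : Module.End K V}
    (hf : f.IsSemisimple) (hg : g.IsSemisimple) (h : f.charpoly = g.charpoly) :
    ∃ e : V ≃ₗ[K] V, ∀ v, e (f v) = g (e v) := by
  classical
  have key : ∀ f : Module.End K V, f.IsSemisimple →
      ∀ d : K → ℕ, (∀ μ, f.charpoly.rootMultiplicity μ = d μ) →
        ∃ b : Module.Basis (Σ μ : K, Fin (d μ)) K V, ∀ i, f (b i) = i.1 • b i := by
    intro f hf d hd'
    have hi := DirectSum.isInternal_submodule_of_iSupIndep_of_iSup_eq_top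
      f.eigenspaces_iSupIndep hf.iSup_eigenspace_eq_top
    have hd : ∀ μ : K, Module.finrank K (f.eigenspace μ) = d μ := by
      intro μ
      rw [← hd', ← LinearMap.finrank_maxGenEigenspace_eq,
        hf.isFinitelySemisimple.maxGenEigenspace_eq_eigenspace]
    refine ⟨hi.collectedBasis fun μ => Module.finBasisOfFinrankEq K _ (hd μ), fun i => ?_⟩
    exact Module.End.mem_eigenspace_iff.mp (hi.collectedBasis_mem _ i)
  obtain ⟨b, hb⟩ := key f hf _ fun _ => rfl
  obtain ⟨c, hc⟩ := key g hg _ fun μ => by rw [← h]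
  refine ⟨b.equiv c (Equiv.refl _), LinearMap.congr_fun (f := (b.equiv c (Equiv.refl _)).toLinearMap
    ∘ₗ f) (g := g ∘ₗ (b.equiv c (Equiv.refl _)).toLinearMap) (b.ext fun i => ?_)⟩
  simp [hb, hc]

/-- The Gram matrix of a real matrix has a symmetric square root that commutes with
everything that commutes with the Gram matrix. -/
theorem Matrix.exists_sqrt_transpose_mul_self {ι : Type*} [Fintype ι] [DecidableEq ι]
    (A : Matrix ι ι ℝ) :
    ∃ S : Matrix ι ι ℝ, Sᵀ = S ∧ S * S = Aᵀ * A ∧ ∀ B, Commute (Aᵀ * A) B → Commute S B := by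
  have hp : (Aᵀ * A).PosSemidef := by
    simpa using Matrix.posSemidef_conjTranspose_mul_self A
  have hs : IsSelfAdjoint (Aᵀ * A) := hp.isHermitian
  refine ⟨cfc Real.sqrt (Aᵀ * A), ?_, ?_, fun B hB => ?_⟩
  · have := cfc_predicate Real.sqrt (Aᵀ * A)
    simpa [IsSelfAdjoint, star_eq_conjTranspose] using this
  · rw [← cfc_mul Real.sqrt Real.sqrt (Aᵀ * A)]
    conv_rhs => rw [← cfc_id ℝ (Aᵀ * A)]
    refine cfc_congr fun x hx => ?_
    rw [hp.isHermitian.spectrum_real_eq_range_eigenvalues] at hx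
    obtain ⟨i, rfl⟩ := hx
    exact Real.mul_self_sqrt (hp.eigenvalues_nonneg i)
  · exact hB.cfc_real _

/-- Orthogonal matrices intertwined by an invertible real matrix are orthogonally conjugate. -/
theorem Matrix.exists_orthogonal_intertwiner {ι : Type*} [Fintype ι] [DecidableEq ι]
    {x y p : Matrix ι ι ℝ} (hx : x ∈ orthogonalGroup ι ℝ) (hy : y ∈ orthogonalGroup ι ℝ)
    (hp : IsUnit p.det) (h : p * x = y * p) :
    ∃ o ∈ orthogonalGroup ι ℝ, o * x = y * o := by
  obtain ⟨S, hS, hSS, hc⟩ := p.exists_sqrt_transpose_mul_self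
  have hSdet : IsUnit S.det := by
    have := congrArg det hSS
    rw [det_mul, det_mul, det_transpose] at this
    exact isUnit_of_mul_isUnit_left (this ▸ hp.mul hp)
  have hx1 : xᵀ * x = 1 := (mem_orthogonalGroup_iff' _ _).mp hx
  have hx2 : x * xᵀ = 1 := (mem_orthogonalGroup_iff _ _).mp hx
  have hy1 : yᵀ * y = 1 := (mem_orthogonalGroup_iff' _ _).mp hy
  have ht : pᵀ * y = x * pᵀ := by
    have h2 : xᵀ * pᵀ = pᵀ * yᵀ := by simpa using congrArg transpose h
    calc pᵀ * y = x * (xᵀ * pᵀ) * y := by rw [← mul_assoc x, hx2, one_mul]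
      _ = x * pᵀ * (yᵀ * y) := by rw [h2]; simp only [mul_assoc]
      _ = x * pᵀ := by rw [hy1, mul_one]
  have hcomm : Commute S x := hc x <| by
    change pᵀ * p * x = x * (pᵀ * p)
    rw [mul_assoc, h, ← mul_assoc, ht, mul_assoc]
  have hinv : S⁻¹ * x = x * S⁻¹ := by
    calc S⁻¹ * x = S⁻¹ * (x * S) * S⁻¹ := by
          rw [mul_assoc, mul_assoc, mul_nonsing_inv S hSdet, mul_one]
      _ = x * S⁻¹ := by rw [← hcomm.eq, ← mul_assoc S⁻¹, nonsing_inv_mul S hSdet, one_mul]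
  refine ⟨p * S⁻¹, ?_, by rw [mul_assoc, hinv, ← mul_assoc, h, mul_assoc]⟩
  rw [mem_orthogonalGroup_iff', transpose_mul, transpose_nonsing_inv, hS]
  calc S⁻¹ * pᵀ * (p * S⁻¹) = S⁻¹ * (pᵀ * p) * S⁻¹ := by simp only [mul_assoc]
    _ = 1 := by
      rw [← hSS, ← mul_assoc, nonsing_inv_mul S hSdet, one_mul, mul_nonsing_inv S hSdet]

/-- Real matrices that are similar over `ℂ` are similar over `ℝ`. -/
theorem Matrix.exists_real_intertwiner {ι : Type*} [Fintype ι] [DecidableEq ι]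
    {x y : Matrix ι ι ℝ} {u : Matrix ι ι ℂ} (hu : IsUnit u.det)
    (h : u * x.map Complex.ofReal = y.map Complex.ofReal * u) :
    ∃ p : Matrix ι ι ℝ, IsUnit p.det ∧ p * x = y * p := by
  set a : Matrix ι ι ℝ := u.map Complex.re with ha
  set b : Matrix ι ι ℝ := u.map Complex.im with hb
  have hax : a * x = y * a := by
    ext i j
    simpa [mul_apply, ha] using congrArg Complex.re (congrFun (congrFun h i) j)
  have hbx : b * x = y * b := by
    ext i j
    simpa [mul_apply, hb] using congrArg Complex.im (congrFun (congrFun h i) j)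
  let q : Polynomial ℝ :=
    (a.map Polynomial.C + (Polynomial.X : Polynomial ℝ) • b.map Polynomial.C).det
  have hq : q ≠ 0 := by
    intro hq
    have h1 : Polynomial.eval₂RingHom Complex.ofRealHom Complex.I q = u.det := by
      rw [RingHom.map_det]
      congr 1
      ext i j
      simp [a, b, Complex.re_add_im]
    rw [hq, map_zero] at h1
    exact hu.ne_zero h1.symm
  obtain ⟨t, ht⟩ : ∃ t : ℝ, q.eval t ≠ 0 := by
    by_contra! hcon
    exact hq (Polynomial.funext fun t => by simpa using hcon t)
  refine ⟨a + t • b, ?_, ?_⟩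
  · have h1 : Polynomial.evalRingHom t q = (a + t • b).det := by
      rw [RingHom.map_det]
      congr 1
      ext i j
      simp [mul_comm t]
    rw [isUnit_iff_ne_zero, ← h1]
    exact ht
  · rw [add_mul, mul_add, smul_mul_assoc, mul_smul_comm, hax, hbx]

/-- A complex matrix of finite order is semisimple. -/
theorem Matrix.isSemisimple_toLin'_of_pow_eq_one {ι : Type*} [Fintype ι] [DecidableEq ι]
    {x : Matrix ι ι ℂ} {m : ℕ} (hm : m ≠ 0) (hx : x ^ m = 1) :
    Module.End.IsSemisimple (toLin' x) := by
  refine Module.End.isSemisimple_of_squarefree_aeval_eq_zero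
    (p := (Polynomial.X ^ m - 1 : Polynomial ℂ)) ?_ ?_
  · exact (Polynomial.X_pow_sub_one_separable_iff.mpr (by exact_mod_cast hm)).squarefree
  · have : (toLin' x) ^ m = 1 := by
      rw [← Matrix.toLin'_pow, hx, toLin'_one]; rfl
    simp [this]

/-- Real orthogonal matrices of finite order with the same characteristic polynomial are
orthogonally conjugate. -/
theorem Matrix.exists_orthogonal_conj_of_charpoly_eq {ι : Type*} [Fintype ι] [DecidableEq ι]
    {x y : Matrix ι ι ℝ} (hx : x ∈ orthogonalGroup ι ℝ) (hy : y ∈ orthogonalGroup ι ℝ)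
    {m : ℕ} (hm : m ≠ 0) (hxm : x ^ m = 1) (hym : y ^ m = 1)
    (h : (x.map Complex.ofReal).charpoly = (y.map Complex.ofReal).charpoly) :
    ∃ o ∈ orthogonalGroup ι ℝ, o * x = y * o := by
  have hpow : ∀ z : Matrix ι ι ℝ, z ^ m = 1 → (z.map Complex.ofReal) ^ m = 1 := by
    intro z hz
    have := congrArg (Complex.ofRealHom.mapMatrix) hz
    rwa [map_pow, map_one] at this
  obtain ⟨e, he⟩ := (isSemisimple_toLin'_of_pow_eq_one hm
    (hpow x hxm)).exists_linearEquiv_of_charpoly_eq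
      (isSemisimple_toLin'_of_pow_eq_one hm (hpow y hym)) (by simpa using h)
  have hdet : IsUnit (LinearMap.toMatrix' (e : (ι → ℂ) →ₗ[ℂ] ι → ℂ)).det := by
    rw [LinearMap.det_toMatrix']
    exact e.isUnit_det'
  obtain ⟨p, hp, hpx⟩ := exists_real_intertwiner (x := x) (y := y) hdet (by
    apply toLin'.injective
    rw [toLin'_mul, toLin'_mul, toLin'_toMatrix']
    exact LinearMap.ext he)
  exact exists_orthogonal_intertwiner hx hy hp hpx

/-- A real endomorphism commuting with a complex structure has nonnegative determinant. -/
theorem LinearMap.det_nonneg_of_commute {V : Type*} [AddCommGroup V] [Module ℝ V]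
    [FiniteDimensional ℝ V] {J h : Module.End ℝ V} (hJ : J * J = -1) (hc : Commute h J) :
    0 ≤ LinearMap.det h := by
  let : Module ℂ V := Module.compHom V (Complex.lift ⟨J, hJ⟩ : ℂ →ₐ[ℝ] Module.End ℝ V).toRingHom
  have hsmul : ∀ (z : ℂ) (v : V), z • v = z.re • v + z.im • J v := by
    intro z v
    change (Complex.lift ⟨J, hJ⟩ : ℂ →ₐ[ℝ] Module.End ℝ V) z v = _
    simp [Complex.liftAux_apply]
  have : IsScalarTower ℝ ℂ V := ⟨fun r z v => by simp [hsmul, mul_smul]⟩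
  have : FiniteDimensional ℂ V := Module.Finite.of_restrictScalars_finite ℝ ℂ V
  let h' : V →ₗ[ℂ] V :=
    { toFun := h
      map_add' := map_add h
      map_smul' := fun z v => by
        have : h (J v) = J (h v) := LinearMap.congr_fun hc.eq v
        simp [hsmul, this] }
  have hh : h = h'.restrictScalars ℝ := rfl
  rw [hh, LinearMap.det_restrictScalars, Algebra.norm_complex_apply]
  exact Complex.normSq_nonneg _

/-- A real matrix commuting with an invertible skew-symmetric matrix has nonnegative
determinant. -/
theorem Matrix.det_nonneg_of_commute_skew {ι : Type*} [Fintype ι] [DecidableEq ι]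
    {A h : Matrix ι ι ℝ} (hA : Aᵀ = -A) (hu : IsUnit A.det) (hc : Commute h A) : 0 ≤ h.det := by
  obtain ⟨S, hS, hSS, hcS⟩ := A.exists_sqrt_transpose_mul_self
  rw [hA] at hSS hcS
  have hSdet : IsUnit S.det := by
    have := congrArg det hSS
    rw [det_mul, det_mul, ← hA, det_transpose] at this
    exact isUnit_of_mul_isUnit_left (this ▸ hu.mul hu)
  have hSi := nonsing_inv_mul S hSdet
  have hSi' := mul_nonsing_inv S hSdet
  have hinv : ∀ B, Commute (-A * A) B → Commute B S⁻¹ := by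
    intro B hB
    have := (hcS B hB).eq
    change B * S⁻¹ = S⁻¹ * B
    calc B * S⁻¹ = S⁻¹ * (S * B) * S⁻¹ := by rw [← mul_assoc, hSi, one_mul]
      _ = S⁻¹ * B := by rw [this, mul_assoc, mul_assoc, hSi', mul_one]
  have hAS : Commute A S⁻¹ := hinv A (by simp [Commute, SemiconjBy, mul_assoc])
  have hhS : Commute h S⁻¹ := hinv h (hc.neg_right.mul_right hc).symm
  have hJ : (A * S⁻¹) * (A * S⁻¹) = -1 := by
    calc (A * S⁻¹) * (A * S⁻¹) = A * (S⁻¹ * A) * S⁻¹ := by simp only [mul_assoc]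
      _ = -((-A * A) * S⁻¹ * S⁻¹) := by rw [← hAS.eq]; simp only [neg_mul, mul_assoc, neg_neg]
      _ = -1 := by rw [← hSS, mul_assoc S, hSi', mul_one, hSi']
  rw [← LinearMap.det_toLin']
  refine LinearMap.det_nonneg_of_commute (J := toLin' (A * S⁻¹)) ?_ ?_
  · rw [Module.End.mul_eq_comp, ← toLin'_mul, hJ, map_neg, toLin'_one]
    rfl
  · rw [commute_iff_eq, Module.End.mul_eq_comp, Module.End.mul_eq_comp, ← toLin'_mul, ← toLin'_mul,
      (hc.mul_right hhS).eq]

/-- The number of multisets of size `n` with exactly `s` distinct elements, all taken from `U`. -/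
theorem Multiset.ncard_setOf_card_toFinset {α : Type*} [DecidableEq α] (U : Finset α) (n s : ℕ)
    (hn : 0 < n) (hs : 0 < s) :
    {M : Multiset α | M.card = n ∧ M.toFinset ⊆ U ∧ M.toFinset.card = s}.ncard
      = U.card.choose s * (n - 1).choose (s - 1) := by
  rcases lt_or_ge n s with h | h
  · rw [Nat.choose_eq_zero_of_lt (by omega : n - 1 < s - 1), mul_zero]
    convert Set.ncard_empty (Multiset α)
    ext M
    simp only [Set.mem_ofPred_eq, Set.mem_empty_iff_false, iff_false]
    rintro ⟨hM, -, rfl⟩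
    have := M.toFinset_card_le
    omega
  let F : Finset α → Finset (Multiset α) := fun S =>
    (S.finsuppAntidiag (n - s)).image fun f => S.val + Finsupp.toMultiset f
  have hF : ∀ S : Finset α, S.card = s → ∀ M, M ∈ F S ↔ M.card = n ∧ M.toFinset = S := by
    intro S hS M
    simp only [F, Finset.mem_image, Finset.mem_finsuppAntidiag']
    constructor
    · rintro ⟨f, ⟨hf, hsup⟩, rfl⟩
      refine ⟨?_, ?_⟩
      · rw [Multiset.card_add, Finsupp.card_toMultiset, Finset.card_val, hS]
        have : f.sum (fun _ => id) = n - s := hf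
        omega
      · rw [Multiset.toFinset_add, Finset.val_toFinset, Finsupp.toFinset_toMultiset]
        exact Finset.union_eq_left.mpr hsup
    · rintro ⟨hM, rfl⟩
      have hle : M.toFinset.val ≤ M := by
        rw [Multiset.toFinset_val]
        exact Multiset.dedup_le M
      refine ⟨Multiset.toFinsupp (M - M.toFinset.val), ⟨?_, ?_⟩, ?_⟩
      · change (Multiset.toFinsupp (M - M.toFinset.val)).sum (fun _ => id) = n - s
        rw [Multiset.toFinsupp_sum_eq, Multiset.card_sub hle, hM, Finset.card_val, hS]
      · rw [Multiset.toFinsupp_support]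
        exact Multiset.toFinset_subset.mpr (Multiset.subset_of_le (Multiset.sub_le_self _ _))
      · rw [Multiset.toFinsupp_toMultiset, add_tsub_cancel_of_le hle]
  have hFcard : ∀ S ∈ U.powersetCard s, (F S).card = (n - 1).choose (s - 1) := by
    intro S hS
    rw [Finset.card_image_of_injective, Finset.card_finsuppAntidiag_nat_eq_choose,
      (Finset.mem_powersetCard.mp hS).2, ← Nat.choose_symm (by omega)]
    · congr 1 <;> omega
    · exact fun f g hfg => Multiset.toFinsupp.symm.injective (add_left_cancel hfg)
  have hunion : {M : Multiset α | M.card = n ∧ M.toFinset ⊆ U ∧ M.toFinset.card = s} =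
      ((U.powersetCard s).biUnion F : Finset (Multiset α)) := by
    ext M
    simp only [Set.mem_ofPred_eq, Finset.mem_coe, Finset.mem_biUnion]
    constructor
    · rintro ⟨hM, hU, hMs⟩
      exact ⟨M.toFinset, Finset.mem_powersetCard.mpr ⟨hU, hMs⟩, (hF _ hMs M).mpr ⟨hM, rfl⟩⟩
    · rintro ⟨S, hS, hM⟩
      obtain ⟨hU, hS⟩ := Finset.mem_powersetCard.mp hS
      obtain ⟨hMn, rfl⟩ := (hF S hS M).mp hM
      exact ⟨hMn, hU, hS⟩
  rw [hunion, Set.ncard_coe_finset, Finset.card_biUnion, Finset.sum_congr rfl hFcard,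
    Finset.sum_const, Finset.card_powersetCard, smul_eq_mul]
  intro S hS T hT hST
  refine Finset.disjoint_left.mpr fun M hM hM' => ?_
  exact hST (((hF S (Finset.mem_powersetCard.mp hS).2 M).mp hM).2.symm.trans
    ((hF T (Finset.mem_powersetCard.mp hT).2 M).mp hM').2)

theorem Multiset.finite_setOf_card_toFinset {α : Type*} [DecidableEq α] (U : Finset α) (n s : ℕ) :
    {M : Multiset α | M.card = n ∧ M.toFinset ⊆ U ∧ M.toFinset.card = s}.Finite := by
  refine (Set.finite_Iic (n • U.val)).subset fun M hM => Multiset.le_iff_count.mpr fun a => ?_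
  obtain ⟨rfl, hU, -⟩ := hM
  by_cases ha : a ∈ M
  · have : 1 ≤ U.val.count a :=
      Multiset.one_le_count_iff_mem.mpr (hU (Multiset.mem_toFinset.mpr ha))
    rw [Multiset.count_nsmul]
    nlinarith [Multiset.count_le_card a M]
  · simp [Multiset.count_eq_zero_of_notMem ha]

theorem Complex.eq_one_of_pow_eq_one_of_im_eq_zero {m : ℕ} (hm : Odd m) {z : ℂ} (hz : z ^ m = 1)
    (h : z.im = 0) : z = 1 := by
  have hz' : z = (z.re : ℂ) := Complex.ext rfl (by simpa using h)
  rw [hz'] at hz ⊢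
  have : z.re ^ m = 1 := by exact_mod_cast hz
  rw [(hm.strictMono_pow.injective (by simpa using this) : z.re = 1), Complex.ofReal_one]

/-- The `m`-th roots of unity in the closed upper half plane. -/
noncomputable def upperRootsOfUnity (m : ℕ) : Finset ℂ :=
  (Polynomial.nthRootsFinset m (1 : ℂ)).filter (0 ≤ ·.im)

theorem mem_upperRootsOfUnity {m : ℕ} (hm : 0 < m) {z : ℂ} :
    z ∈ upperRootsOfUnity m ↔ z ^ m = 1 ∧ 0 ≤ z.im := by
  simp [upperRootsOfUnity, Polynomial.mem_nthRootsFinset hm]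

theorem one_mem_upperRootsOfUnity {m : ℕ} (hm : 0 < m) : 1 ∈ upperRootsOfUnity m := by
  simp [mem_upperRootsOfUnity hm]

theorem card_upperRootsOfUnity {m : ℕ} (hm : Odd m) : (upperRootsOfUnity m).card = m / 2 + 1 := by
  have h0 : 0 < m := hm.pos
  have hsplit : Polynomial.nthRootsFinset m (1 : ℂ) =
      upperRootsOfUnity m ∪ ((upperRootsOfUnity m).erase 1).image (starRingEnd ℂ) := by
    ext z
    simp only [Polynomial.mem_nthRootsFinset h0, Finset.mem_union, Finset.mem_image,
      Finset.mem_erase, mem_upperRootsOfUnity h0]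
    constructor
    · intro hz
      rcases le_or_gt 0 z.im with h | h
      · exact Or.inl ⟨hz, h⟩
      · refine Or.inr ⟨starRingEnd ℂ z, ⟨?_, ?_, ?_⟩, Complex.conj_conj z⟩
        · intro h1
          have := congrArg Complex.im h1
          simp at this
          exact h.ne this
        · rw [← map_pow, hz, map_one]
        · simpa using h.le
    · rintro (h | ⟨w, ⟨-, hw, -⟩, rfl⟩)
      · exact h.1
      · rw [← map_pow, hw, map_one]
  have hdisj : Disjoint (upperRootsOfUnity m)
      (((upperRootsOfUnity m).erase 1).image (starRingEnd ℂ)) := by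
    rw [Finset.disjoint_left]
    intro z hz hz'
    simp only [Finset.mem_image, Finset.mem_erase, mem_upperRootsOfUnity h0] at hz hz'
    obtain ⟨w, ⟨hw1, hw, hw0⟩, rfl⟩ := hz'
    refine hw1 (Complex.eq_one_of_pow_eq_one_of_im_eq_zero hm hw ?_)
    have := hz.2
    rw [Complex.conj_im] at this
    linarith
  have hcard := (Complex.isPrimitiveRoot_exp m h0.ne').card_nthRootsFinset
  rw [hsplit, Finset.card_union_of_disjoint hdisj,
    Finset.card_image_of_injective _ (starRingEnd ℂ).injective,
    Finset.card_erase_of_mem (one_mem_upperRootsOfUnity h0)] at hcard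
  have : 0 < (upperRootsOfUnity m).card := Finset.card_pos.mpr ⟨1, one_mem_upperRootsOfUnity h0⟩
  have := Nat.odd_iff.mp hm
  omega

theorem Multiset.count_map_conj (M : Multiset ℂ) (z : ℂ) :
    (M.map (starRingEnd ℂ)).count z = M.count (starRingEnd ℂ z) := by
  conv_lhs => rw [← Complex.conj_conj z]
  exact Multiset.count_map_eq_count' _ _ (starRingEnd ℂ).injective _

/-- A multiset in the closed upper half plane is determined by its sum with its conjugate. -/
theorem Multiset.eq_of_add_map_conj_eq {M N : Multiset ℂ} (hM : ∀ z ∈ M, 0 ≤ z.im)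
    (hN : ∀ z ∈ N, 0 ≤ z.im)
    (h : M + M.map (starRingEnd ℂ) = N + N.map (starRingEnd ℂ)) : M = N := by
  ext z
  have hz := congrArg (Multiset.count z) h
  simp only [Multiset.count_add, Multiset.count_map_conj] at hz
  have hneg : ∀ w : ℂ, w.im < 0 → M.count w = 0 ∧ N.count w = 0 := fun w hw =>
    ⟨Multiset.count_eq_zero.mpr fun h => (hM w h).not_gt hw,
      Multiset.count_eq_zero.mpr fun h => (hN w h).not_gt hw⟩
  rcases lt_trichotomy z.im 0 with h0 | h0 | h0
  · rw [(hneg z h0).1, (hneg z h0).2]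
  · rw [Complex.conj_eq_iff_im.mpr h0] at hz
    omega
  · obtain ⟨h1, h2⟩ := hneg (starRingEnd ℂ z) (by simpa using h0)
    omega

/-- A conjugation-invariant multiset of `2 * n` roots of unity of odd order splits into
conjugate pairs. -/
theorem Multiset.exists_eq_add_map_conj {R : Multiset ℂ} {n m : ℕ} (hm : Odd m)
    (hcard : R.card = 2 * n) (hR : ∀ z ∈ R, z ^ m = 1) (hconj : R.map (starRingEnd ℂ) = R) :
    ∃ M : Multiset ℂ, M.card = n ∧ (∀ z ∈ M, z ^ m = 1 ∧ 0 ≤ z.im) ∧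
      M + M.map (starRingEnd ℂ) = R := by
  classical
  have hc : ∀ z, R.count (starRingEnd ℂ z) = R.count z := fun z => by
    rw [← Multiset.count_map_conj, hconj]
  set P := R.filter (0 < ·.im) with hP
  have hsplit : P + P.map (starRingEnd ℂ) + Multiset.replicate (R.count 1) 1 = R := by
    ext z
    simp only [Multiset.count_add, Multiset.count_map_conj, hP, Multiset.count_filter,
      Multiset.count_replicate, Complex.conj_im, hc]
    rcases lt_trichotomy z.im 0 with h0 | h0 | h0
    · have : (1 : ℂ) ≠ z := by rintro rfl; simp at h0
      simp [h0, h0.not_gt, this]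
    · by_cases h1 : (1 : ℂ) = z
      · subst h1; simp
      · have : R.count z = 0 := Multiset.count_eq_zero.mpr fun h =>
          h1 (Complex.eq_one_of_pow_eq_one_of_im_eq_zero hm (hR z h) h0).symm
        simp [h0, h1, this]
    · have : (1 : ℂ) ≠ z := by rintro rfl; simp at h0
      simp [h0, h0.not_gt, this]
  have hcard' := congrArg Multiset.card hsplit
  simp only [Multiset.card_add, Multiset.card_map, Multiset.card_replicate, hcard] at hcard'
  obtain ⟨k, hk⟩ : ∃ k, R.count 1 = k + k := ⟨n - P.card, by omega⟩
  refine ⟨P + Multiset.replicate k 1, ?_, ?_, ?_⟩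
  · rw [Multiset.card_add, Multiset.card_replicate]
    omega
  · intro z hz
    rcases Multiset.mem_add.mp hz with h | h
    · have := Multiset.mem_filter.mp h
      exact ⟨hR z this.1, this.2.le⟩
    · simp [Multiset.eq_of_mem_replicate h]
  · conv_rhs => rw [← hsplit, hk, Multiset.replicate_add]
    rw [Multiset.map_add, Multiset.map_replicate, map_one]
    abel

theorem Multiset.setOf_mem_add_map_conj {M : Multiset ℂ} (hM : ∀ z ∈ M, 0 ≤ z.im) :
    {z : ℂ | z ∈ M + M.map (starRingEnd ℂ) ∧ 0 ≤ z.im} = M.toFinset := by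
  ext z
  simp only [Set.mem_ofPred_eq, Multiset.mem_add, Multiset.mem_map, Finset.mem_coe,
    Multiset.mem_toFinset]
  constructor
  · rintro ⟨h | ⟨w, hw, rfl⟩, hz⟩
    · exact h
    · have h1 := hM w hw
      rw [Complex.conj_im] at hz
      rwa [Complex.conj_eq_iff_im.mpr (by linarith)]
  · exact fun h => ⟨Or.inl h, hM z h⟩

/-- The complex eigenvalues of a real matrix, with multiplicity. -/
noncomputable def Matrix.complexRoots {ι : Type*} [Fintype ι] [DecidableEq ι]
    (x : Matrix ι ι ℝ) : Multiset ℂ :=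
  (x.map Complex.ofReal).charpoly.roots

namespace Matrix

variable {ι : Type*} [Fintype ι] [DecidableEq ι]

theorem complexRoots_eq_roots_map (x : Matrix ι ι ℝ) :
    x.complexRoots = (x.charpoly.map Complex.ofRealHom).roots := by
  rw [← charpoly_map]
  rfl

theorem card_complexRoots (x : Matrix ι ι ℝ) : x.complexRoots.card = Fintype.card ι := by
  rw [complexRoots, IsAlgClosed.card_roots_eq_natDegree, charpoly_natDegree_eq_dim]

theorem map_conj_complexRoots (x : Matrix ι ι ℝ) :
    x.complexRoots.map (starRingEnd ℂ) = x.complexRoots := by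
  have h : (x.map Complex.ofReal).charpoly.map (starRingEnd ℂ) =
      (x.map Complex.ofReal).charpoly := by
    rw [← charpoly_map]
    congr 1
    ext i j
    simp
  conv_rhs => rw [complexRoots, ← h]
  exact (Polynomial.Splits.roots_map (IsAlgClosed.splits _) _).symm

theorem mem_complexRoots {x : Matrix ι ι ℝ} {z : ℂ} :
    z ∈ x.complexRoots ↔ z ∈ spectrum ℂ (x.map Complex.ofReal) := by
  rw [complexRoots, Polynomial.mem_roots (charpoly_monic _).ne_zero,
    mem_spectrum_iff_isRoot_charpoly]

theorem pow_eq_one_of_mem_complexRoots {x : Matrix ι ι ℝ} {m : ℕ} (hx : x ^ m = 1) {z : ℂ}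
    (hz : z ∈ x.complexRoots) : z ^ m = 1 := by
  have h := spectrum.pow_mem_pow _ m (mem_complexRoots.mp hz)
  have hpow : (x.map Complex.ofReal) ^ m = 1 := by
    have := congrArg (Complex.ofRealHom.mapMatrix) hx
    rwa [map_pow, map_one] at this
  rw [hpow] at h
  cases isEmpty_or_nonempty ι
  · have : Subsingleton (Matrix ι ι ℂ) := inferInstance
    simp [spectrum.of_subsingleton] at h
  · simpa [spectrum.one_eq] using h

theorem charpoly_eq_of_complexRoots_eq {x y : Matrix ι ι ℝ}
    (h : x.complexRoots = y.complexRoots) :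
    (x.map Complex.ofReal).charpoly = (y.map Complex.ofReal).charpoly := by
  have hsplit := fun z : Matrix ι ι ℝ =>
    (IsAlgClosed.splits (z.map Complex.ofReal).charpoly).eq_prod_roots_of_monic (charpoly_monic _)
  rw [hsplit x, hsplit y]
  exact congrArg _ (congrArg _ h)

theorem complexRoots_eq_of_conj {x y g : Matrix ι ι ℝ} (hg : IsUnit g.det) (h : g * x = y * g) :
    x.complexRoots = y.complexRoots := by
  have hy : y = g * x * g⁻¹ := by rw [h, mul_assoc, mul_nonsing_inv g hg, mul_one]
  obtain ⟨u, rfl⟩ := (isUnit_iff_isUnit_det g).mpr hg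
  rw [complexRoots_eq_roots_map, complexRoots_eq_roots_map, hy, charpoly_units_conj]

theorem one_mem_complexRoots_iff {x : Matrix ι ι ℝ} :
    1 ∈ x.complexRoots ↔ ∃ v : ι → ℝ, v ≠ 0 ∧ x *ᵥ v = v := by
  have h1 : 1 ∈ x.complexRoots ↔ x.charpoly.IsRoot 1 := by
    rw [complexRoots_eq_roots_map, Polynomial.mem_roots ((charpoly_monic x).map _).ne_zero,
      Polynomial.IsRoot, Polynomial.eval_one_map]
    simp
  rw [h1, Polynomial.IsRoot, eval_charpoly, ← exists_mulVec_eq_zero_iff]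
  simp only [sub_mulVec, sub_eq_zero, map_one, one_mulVec, ne_eq, eq_comm]

/-- An orthogonal matrix with a nonzero fixed vector commutes with a reflection. -/
theorem exists_orthogonal_commute_det_neg_one {x : Matrix ι ι ℝ} (hx : x ∈ orthogonalGroup ι ℝ)
    (h1 : 1 ∈ x.complexRoots) :
    ∃ h ∈ orthogonalGroup ι ℝ, h.det = -1 ∧ h * x = x * h := by
  obtain ⟨v, hv, hxv⟩ := one_mem_complexRoots_iff.mp h1
  have hvv : v ⬝ᵥ v ≠ 0 := by simpa using hv
  have hvx : v ᵥ* x = v := by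
    have hx1 : xᵀ * x = 1 := (mem_orthogonalGroup_iff' _ _).mp hx
    rw [← mulVec_transpose]
    conv_lhs => rw [← hxv]
    rw [mulVec_mulVec, hx1, one_mulVec]
  refine ⟨1 - (2 / (v ⬝ᵥ v)) • vecMulVec v v, ?_, ?_, ?_⟩
  · rw [mem_orthogonalGroup_iff]
    have ht : (1 - (2 / (v ⬝ᵥ v)) • vecMulVec v v)ᵀ = 1 - (2 / (v ⬝ᵥ v)) • vecMulVec v v := by
      simp [transpose_vecMulVec]
    have hsq : vecMulVec v v * vecMulVec v v = (v ⬝ᵥ v) • vecMulVec v v := by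
      rw [vecMulVec_mul_vecMulVec]
      ext i j
      simp [vecMulVec_apply]
      ring
    rw [ht, sub_mul, one_mul, mul_sub, mul_one, smul_mul_smul_comm, hsq, smul_smul]
    have : 2 / (v ⬝ᵥ v) * (2 / (v ⬝ᵥ v)) * (v ⬝ᵥ v) = 2 / (v ⬝ᵥ v) + 2 / (v ⬝ᵥ v) := by
      field_simp
      norm_num
    rw [this, add_smul]
    abel
  · have := det_one_add_replicateCol_mul_replicateRow (ι := Unit) (-(2 / (v ⬝ᵥ v)) • v) v
    rw [← vecMulVec_eq] at this
    rw [sub_eq_add_neg, ← neg_smul, ← smul_vecMulVec, this, dotProduct_smul, smul_eq_mul]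
    field_simp
    norm_num
  · rw [sub_mul, mul_sub, one_mul, mul_one, smul_mul_assoc, mul_smul_comm, vecMulVec_mul, hvx,
      mul_vecMulVec, hxv]

/-- A matrix commuting with an orthogonal matrix of odd order that does not have the eigenvalue `1`
has nonnegative determinant. -/
theorem det_nonneg_of_commute_orthogonal {x h : Matrix ι ι ℝ} (hx : x ∈ orthogonalGroup ι ℝ)
    {m : ℕ} (hm : Odd m) (hxm : x ^ m = 1) (h1 : 1 ∉ x.complexRoots)
    (hc : h * x = x * h) : 0 ≤ h.det := by
  have hx1 : xᵀ * x = 1 := (mem_orthogonalGroup_iff' _ _).mp hx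
  have hx2 : x * xᵀ = 1 := (mem_orthogonalGroup_iff _ _).mp hx
  have hc' : h * xᵀ = xᵀ * h := by
    calc h * xᵀ = xᵀ * (x * h) * xᵀ := by rw [← mul_assoc xᵀ, hx1, one_mul]
      _ = xᵀ * h * (x * xᵀ) := by rw [← hc]; simp only [mul_assoc]
      _ = xᵀ * h := by rw [hx2, mul_one]
  refine det_nonneg_of_commute_skew (A := x - xᵀ) (by simp) ?_ (Commute.sub_right hc hc')
  rw [isUnit_iff_ne_zero]
  intro hdet
  obtain ⟨v, hv, hAv⟩ := exists_mulVec_eq_zero_iff.mpr hdet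
  rw [sub_mulVec, sub_eq_zero] at hAv
  have hsq : (x ^ 2) *ᵥ v = v := by
    rw [pow_two, ← mulVec_mulVec, hAv, mulVec_mulVec, hx2, one_mulVec]
  obtain ⟨k, rfl⟩ := hm
  have heven : ∀ j : ℕ, (x ^ (2 * j)) *ᵥ v = v := by
    intro j
    induction j with
    | zero => simp
    | succ j ih => rw [mul_add, mul_one, pow_add, ← mulVec_mulVec, hsq, ih]
  refine h1 (one_mem_complexRoots_iff.mpr ⟨v, hv, ?_⟩)
  calc x *ᵥ v = x *ᵥ (x ^ (2 * k)) *ᵥ v := by rw [heven]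
    _ = v := by rw [mulVec_mulVec, ← pow_succ', hxm, one_mulVec]

/-- Every multiset of roots of unity is realised by a block diagonal matrix of rotations. -/
theorem exists_complexRoots_eq {n m : ℕ} {M : Multiset ℂ} (hm : m ≠ 0) (hcard : M.card = n)
    (hM : ∀ z ∈ M, z ^ m = 1) :
    ∃ x ∈ orthogonalGroup (Fin (2 * n)) ℝ, x.det = 1 ∧ x ^ m = 1 ∧
      x.complexRoots = M + M.map (starRingEnd ℂ) := by
  obtain ⟨a, rfl⟩ : ∃ a : Fin n → ℂ, M = Finset.univ.val.map a := by
    subst hcard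
    refine ⟨fun i => M.toList.get (Fin.cast M.length_toList.symm i), ?_⟩
    rw [Fin.univ_val_map, ← List.ofFn_congr M.length_toList, List.ofFn_get, Multiset.coe_toList]
  have ha : ∀ i, a i ^ m = 1 := fun i => hM _ (by simp)
  have hnorm : ∀ i, Complex.normSq (a i) = 1 := fun i => by
    rw [Complex.normSq_eq_norm_sq, Complex.norm_eq_one_of_pow_eq_one (ha i) hm, one_pow]
  let L := Algebra.leftMulMatrix Complex.basisOneI
  let B := blockDiagonal fun i => L (a i)
  let e : Fin 2 × Fin n ≃ Fin (2 * n) := finProdFinEquiv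
  have hBpow : B ^ m = 1 := by
    rw [← blockDiagonal_pow, ← blockDiagonal_one]
    congr 1
    ext1 i
    simp only [Pi.pow_apply, Pi.one_apply]
    rw [← map_pow, ha, map_one]
  have hdetL : ∀ i, (L (a i)).det = 1 := fun i => by
    rw [← Algebra.norm_eq_matrix_det, Algebra.norm_complex_apply, hnorm]
  have hLT : ∀ i, L (a i) * (L (a i))ᵀ = 1 := fun i => by
    have := hnorm i
    rw [Complex.normSq_apply] at this
    simp only [L, Algebra.leftMulMatrix_complex]
    ext j k
    fin_cases j <;> fin_cases k <;> simp [mul_apply, Fin.sum_univ_two] <;> linarith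
  have hBB : B * Bᵀ = 1 := by
    rw [blockDiagonal_transpose, ← blockDiagonal_mul, ← blockDiagonal_one]
    exact congrArg _ (funext hLT)
  refine ⟨reindexAlgEquiv ℝ ℝ e B, ?_, ?_, ?_, ?_⟩
  · rw [mem_orthogonalGroup_iff, coe_reindexAlgEquiv, transpose_reindex]
    have := congrArg (reindexAlgEquiv ℝ ℝ e) hBB
    rwa [map_mul, map_one] at this
  · rw [coe_reindexAlgEquiv, det_reindex_self, det_blockDiagonal]
    simp [hdetL]
  · rw [← map_pow, hBpow, map_one]
  · have hchar : (reindexAlgEquiv ℝ ℝ e B).charpoly = ∏ i, (L (a i)).charpoly := by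
      rw [coe_reindexAlgEquiv, charpoly_reindex]
      have : B.charmatrix = blockDiagonal fun i => (L (a i)).charmatrix := by
        ext ⟨j, i⟩ ⟨k, l⟩
        by_cases hil : i = l
        · subst hil
          by_cases hjk : j = k
          · subst hjk
            simp [B]
          · simp [B, hjk]
        · simp [B, hil, blockDiagonal_apply_ne]
      rw [charpoly, this, det_blockDiagonal]
      rfl
    have hblock : ∀ i, (L (a i)).charpoly.map Complex.ofRealHom =
        (Polynomial.X - Polynomial.C (a i)) *
          (Polynomial.X - Polynomial.C (starRingEnd ℂ (a i))) := by
      intro i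
      have h1 : (L (a i)).trace = 2 * (a i).re := by
        simp [L, Algebra.leftMulMatrix_complex, trace_fin_two]
        ring
      have h2 : Polynomial.C (a i) + Polynomial.C (starRingEnd ℂ (a i)) =
          Polynomial.C (((2 * (a i).re : ℝ) : ℂ)) := by
        rw [← map_add, Complex.add_conj]
      have h3 : Polynomial.C (a i) * Polynomial.C (starRingEnd ℂ (a i)) = 1 := by
        rw [← map_mul, Complex.mul_conj, hnorm, Complex.ofReal_one, map_one]
      rw [charpoly_fin_two, hdetL, h1]
      simp only [Polynomial.map_add, Polynomial.map_sub, Polynomial.map_pow, Polynomial.map_mul,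
        Polynomial.map_X, Polynomial.map_C, Polynomial.map_one, map_one, Complex.ofRealHom_eq_coe]
      linear_combination Polynomial.X * h2 - h3
    rw [complexRoots_eq_roots_map, hchar, Polynomial.map_prod]
    simp only [hblock]
    have hroots : ∀ b : Fin n → ℂ,
        (∏ i, (Polynomial.X - Polynomial.C (b i))).roots = Finset.univ.val.map b := by
      intro b
      have := Polynomial.roots_multiset_prod_X_sub_C (Finset.univ.val.map b)
      rwa [Multiset.map_map] at this
    rw [Finset.prod_mul_distrib, Polynomial.roots_mul, hroots, hroots, Multiset.map_map]
    · rfl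
    · exact mul_ne_zero (Finset.prod_ne_zero_iff.mpr fun i _ => Polynomial.X_sub_C_ne_zero _)
        (Finset.prod_ne_zero_iff.mpr fun i _ => Polynomial.X_sub_C_ne_zero _)

end Matrix

namespace SO

variable {k : ℕ}

theorem coe_pow (x : SO k) (m : ℕ) : (x ^ m).1.1 = x.1.1 ^ m := rfl

theorem pow_eq_one_iff {x : SO k} {m : ℕ} : x ^ m = 1 ↔ x.1.1 ^ m = 1 := by
  rw [← coe_pow, Subtype.ext_iff, Subtype.ext_iff]
  rfl

theorem isConj_iff_exists_orthogonal {x y : SO k} :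
    IsConj x y ↔ ∃ g ∈ orthogonalGroup (Fin k) ℝ, g.det = 1 ∧ g * x.1.1 = y.1.1 * g := by
  simp only [isConj_iff, mul_inv_eq_iff_eq_mul, Subtype.ext_iff]
  exact ⟨fun ⟨g, hg⟩ => ⟨g.1.1, g.1.2, g.2, hg⟩, fun ⟨g, hg, hdet, h⟩ => ⟨⟨⟨g, hg⟩, hdet⟩, h⟩⟩

end SO

namespace Matrix

variable {ι : Type*} [Fintype ι] [DecidableEq ι]

theorem isUnit_det_of_mem_orthogonalGroup
    {g : Matrix ι ι ℝ} (hg : g ∈ orthogonalGroup ι ℝ) : IsUnit g.det :=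
  (isUnit_iff_isUnit_det g).mp (IsUnit.of_mul_eq_one _ ((mem_orthogonalGroup_iff _ _).mp hg))

theorem det_eq_one_or_neg_one_of_mem_orthogonalGroup
    {g : Matrix ι ι ℝ} (hg : g ∈ orthogonalGroup ι ℝ) : g.det = 1 ∨ g.det = -1 := by
  have h : g * gᵀ = 1 := (mem_orthogonalGroup_iff _ _).mp hg
  have h2 := congrArg det h
  rw [det_mul, det_transpose, det_one] at h2
  exact mul_self_eq_one_iff.mp h2

end Matrix

theorem IsConj.complexRoots_eq {k : ℕ} {x y : SO k} (h : IsConj x y) :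
    x.1.1.complexRoots = y.1.1.complexRoots := by
  obtain ⟨g, hg, -, hgx⟩ := SO.isConj_iff_exists_orthogonal.mp h
  exact complexRoots_eq_of_conj (isUnit_det_of_mem_orthogonalGroup hg) hgx

/-- In positive dimension, conjugation by some reflection acts on the special orthogonal group. -/
theorem SO.exists_reflect {k : ℕ} (hk : 0 < k) :
    ∃ r ∈ orthogonalGroup (Fin k) ℝ, r.det = -1 ∧
      ∀ x : SO k, ∃ y : SO k, r * x.1.1 = y.1.1 * r := by
  obtain ⟨r, hr, hdet, -⟩ := exists_orthogonal_commute_det_neg_one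
    (one_mem (orthogonalGroup (Fin k) ℝ)) (one_mem_complexRoots_iff.mpr
      ⟨fun _ => 1, fun h => one_ne_zero (congrFun h ⟨0, hk⟩), one_mulVec _⟩)
  refine ⟨r, hr, hdet, fun x => ⟨⟨⟨r, hr⟩ * x.1 * ⟨r, hr⟩⁻¹, ?_⟩, ?_⟩⟩
  · change (r * x.1.1 * rᵀ).det = 1
    have hx : x.1.1.det = 1 := x.2
    rw [det_mul, det_mul, det_transpose, hx, hdet]
    norm_num
  · have h : rᵀ * r = 1 := (mem_orthogonalGroup_iff' _ _).mp hr
    change r * x.1.1 = r * x.1.1 * rᵀ * r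
    rw [mul_assoc, h, mul_one]

theorem SO.isConj_or_isConj {k m : ℕ} (hm : m ≠ 0) {r : Matrix (Fin k) (Fin k) ℝ}
    (hr : r ∈ orthogonalGroup (Fin k) ℝ) (hdet : r.det = -1) {x x' y : SO k}
    (hx' : r * x.1.1 = x'.1.1 * r) (hx : x ^ m = 1) (hy : y ^ m = 1)
    (h : x.1.1.complexRoots = y.1.1.complexRoots) : IsConj x y ∨ IsConj x' y := by
  obtain ⟨o, ho, hoxy⟩ := exists_orthogonal_conj_of_charpoly_eq x.1.2 y.1.2 hm
    (SO.pow_eq_one_iff.mp hx) (SO.pow_eq_one_iff.mp hy) (charpoly_eq_of_complexRoots_eq h)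
  rcases det_eq_one_or_neg_one_of_mem_orthogonalGroup ho with hd | hd
  · exact Or.inl (isConj_iff_exists_orthogonal.mpr ⟨o, ho, hd, hoxy⟩)
  · have h1 : r * rᵀ = 1 := (mem_orthogonalGroup_iff _ _).mp hr
    have h2 : rᵀ * r = 1 := (mem_orthogonalGroup_iff' _ _).mp hr
    refine Or.inr (isConj_iff_exists_orthogonal.mpr ⟨o * rᵀ, mul_mem ho ?_, ?_, ?_⟩)
    · exact (mem_orthogonalGroup_iff _ _).mpr (by simpa using h2)
    · rw [det_mul, det_transpose, hd, hdet]
      norm_num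
    · calc o * rᵀ * x'.1.1 = o * rᵀ * (x'.1.1 * r) * rᵀ := by
            simp only [mul_assoc, h1, mul_one]
        _ = o * (rᵀ * r) * x.1.1 * rᵀ := by rw [← hx']; simp only [mul_assoc]
        _ = y.1.1 * (o * rᵀ) := by rw [h2, mul_one, hoxy, mul_assoc]

/-- An element of odd order is conjugate to its mirror image exactly when it has the
eigenvalue `1`. -/
theorem SO.isConj_reflect_iff {k m : ℕ} (hm : Odd m) {r : Matrix (Fin k) (Fin k) ℝ}
    (hr : r ∈ orthogonalGroup (Fin k) ℝ) (hdet : r.det = -1) {x x' : SO k}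
    (hx' : r * x.1.1 = x'.1.1 * r) (hx : x ^ m = 1) :
    IsConj x x' ↔ 1 ∈ x.1.1.complexRoots := by
  have h2 : rᵀ * r = 1 := (mem_orthogonalGroup_iff' _ _).mp hr
  constructor
  · intro h
    by_contra h1
    obtain ⟨g, hg, hgdet, hgx⟩ := isConj_iff_exists_orthogonal.mp h
    have := det_nonneg_of_commute_orthogonal x.1.2 hm (SO.pow_eq_one_iff.mp hx) h1
      (h := rᵀ * g) <| by
        calc rᵀ * g * x.1.1 = rᵀ * x'.1.1 * (r * rᵀ) * g := by
              rw [(mem_orthogonalGroup_iff _ _).mp hr, mul_one, mul_assoc, hgx, mul_assoc]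
          _ = (rᵀ * r) * x.1.1 * rᵀ * g := by
              rw [mul_assoc rᵀ r, hx']; simp only [mul_assoc]
          _ = x.1.1 * (rᵀ * g) := by rw [h2, one_mul, mul_assoc]
    rw [det_mul, det_transpose, hdet, hgdet] at this
    norm_num at this
  · intro h1
    obtain ⟨h, hh, hhdet, hhx⟩ := exists_orthogonal_commute_det_neg_one x.1.2 h1
    refine isConj_iff_exists_orthogonal.mpr ⟨r * h, mul_mem hr hh, ?_, ?_⟩
    · rw [det_mul, hdet, hhdet]
      norm_num
    · rw [mul_assoc, hhx, ← mul_assoc, hx', mul_assoc]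

/-- For any positive integers `n`, `s` and odd positive integer `m`, the number of
conjugacy classes of `SO(2n)` consisting of elements `x` with `x ^ m = 1` and exactly `s`
distinct conjugate pairs of eigenvalues equals
`C(n - 1, s - 1) · (C(⌊m/2⌋, s - 1) + 2 · C(⌊m/2⌋, s))`. -/
theorem stmt_15 (n m s : ℕ) (hn : 0 < n) (hm : 0 < m) (hs : 0 < s) (hodd : Odd m) :
    {c : ConjClasses (SO (2 * n)) | ∀ x ∈ c.carrier,
        x ^ m = 1 ∧
        {z : ℂ | z ∈ spectrum ℂ (((x : Matrix.orthogonalGroup (Fin (2 * n)) ℝ) :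
            Matrix (Fin (2 * n)) (Fin (2 * n)) ℝ).map Complex.ofReal) ∧ 0 ≤ z.im}.ncard = s}.ncard
      = Nat.choose (n - 1) (s - 1) *
          (Nat.choose (m / 2) (s - 1) + 2 * Nat.choose (m / 2) s) := by
  classical
  let T : Finset ℂ → Set (Multiset ℂ) := fun U =>
    {M | M.card = n ∧ M.toFinset ⊆ U ∧ M.toFinset.card = s}
  let U := upperRootsOfUnity m
  have hU : ∀ {M}, M ∈ T U → ∀ z ∈ M, z ^ m = 1 ∧ 0 ≤ z.im := fun hM z hz =>
    (mem_upperRootsOfUnity hm).mp (hM.2.1 (Multiset.mem_toFinset.mpr hz))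
  have herase : ∀ {M}, M ∈ T (U.erase 1) ↔ M ∈ T U ∧ 1 ∉ M := by
    intro M
    simp only [T, Set.mem_ofPred_eq, Finset.subset_erase, Multiset.mem_toFinset]
    tauto
  have hreal : ∀ M : Multiset ℂ, ∃ x : SO (2 * n), M ∈ T U →
      x ^ m = 1 ∧ x.1.1.complexRoots = M + M.map (starRingEnd ℂ) := by
    intro M
    by_cases hM : M ∈ T U
    · obtain ⟨x, hx, hdet, hpow, hroots⟩ :=
        exists_complexRoots_eq hm.ne' hM.1 fun z hz => (hU hM z hz).1
      exact ⟨⟨⟨x, hx⟩, hdet⟩, fun _ => ⟨SO.pow_eq_one_iff.mpr hpow, hroots⟩⟩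
    · exact ⟨1, fun h => absurd h hM⟩
  choose x hx using hreal
  obtain ⟨r, hr, hdet, hrefl⟩ := SO.exists_reflect (k := 2 * n) (by omega)
  choose σ hσ using hrefl
  have hσpow : ∀ y, y ^ m = 1 → (σ y) ^ m = 1 := by
    intro y hy
    rw [SO.pow_eq_one_iff] at hy ⊢
    have h : r * y.1.1 ^ m = (σ y).1.1 ^ m * r := SemiconjBy.pow_right (hσ y) m
    have h1 : r * rᵀ = 1 := (mem_orthogonalGroup_iff _ _).mp hr
    rw [hy, mul_one] at h
    rw [← mul_one ((σ y).1.1 ^ m), ← h1, ← mul_assoc, ← h]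
  have hσroots : ∀ y, (σ y).1.1.complexRoots = y.1.1.complexRoots := fun y =>
    (complexRoots_eq_of_conj (isUnit_det_of_mem_orthogonalGroup hr) (hσ y)).symm
  have hone : ∀ {M : Multiset ℂ}, 1 ∈ M + M.map (starRingEnd ℂ) ↔ 1 ∈ M := by
    intro M
    rw [← Multiset.count_pos, ← Multiset.count_pos, Multiset.count_add, Multiset.count_map_conj,
      map_one]
    omega
  have hinj : ∀ {M N}, M ∈ T U → N ∈ T U →
      (x M).1.1.complexRoots = (x N).1.1.complexRoots → M = N := by
    intro M N hM hN h
    rw [(hx M hM).2, (hx N hN).2] at h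
    exact Multiset.eq_of_add_map_conj_eq (fun z hz => (hU hM z hz).2) (fun z hz => (hU hN z hz).2) h
  have hset : {c : ConjClasses (SO (2 * n)) | ∀ x ∈ c.carrier,
        x ^ m = 1 ∧
        {z : ℂ | z ∈ spectrum ℂ (((x : Matrix.orthogonalGroup (Fin (2 * n)) ℝ) :
            Matrix (Fin (2 * n)) (Fin (2 * n)) ℝ).map Complex.ofReal) ∧ 0 ≤ z.im}.ncard = s} =
      (fun M => ConjClasses.mk (x M)) '' T U ∪
        (fun M => ConjClasses.mk (σ (x M))) '' T (U.erase 1) := by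
    have hmem : ∀ (y : SO (2 * n)) (M : Multiset ℂ), M.card = n → (∀ z ∈ M, z ^ m = 1 ∧ 0 ≤ z.im) →
        y.1.1.complexRoots = M + M.map (starRingEnd ℂ) →
        ({z : ℂ | z ∈ spectrum ℂ (((y : Matrix.orthogonalGroup (Fin (2 * n)) ℝ) :
            Matrix (Fin (2 * n)) (Fin (2 * n)) ℝ).map Complex.ofReal) ∧ 0 ≤ z.im}.ncard = s ↔
          M ∈ T U) := by
      intro y M hMn hM hy
      simp only [← mem_complexRoots, hy]
      rw [Multiset.setOf_mem_add_map_conj fun z hz => (hM z hz).2, Set.ncard_coe_finset]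
      refine ⟨fun h => ⟨hMn, fun z hz => ?_, h⟩, fun h => h.2.2⟩
      exact (mem_upperRootsOfUnity hm).mpr (hM z (Multiset.mem_toFinset.mp hz))
    have hclass : ∀ (y : SO (2 * n)) (M : Multiset ℂ), M ∈ T U → y ^ m = 1 →
        y.1.1.complexRoots = M + M.map (starRingEnd ℂ) → ∀ z ∈ (ConjClasses.mk y).carrier,
        z ^ m = 1 ∧
        {w : ℂ | w ∈ spectrum ℂ (((z : Matrix.orthogonalGroup (Fin (2 * n)) ℝ) :
            Matrix (Fin (2 * n)) (Fin (2 * n)) ℝ).map Complex.ofReal) ∧ 0 ≤ w.im}.ncard = s := by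
      intro y M hM hy hroots z hz
      have hyz : IsConj y z :=
        (ConjClasses.mk_eq_mk_iff_isConj.mp (ConjClasses.mem_carrier_iff_mk_eq.mp hz)).symm
      refine ⟨?_, (hmem z M hM.1 (hU hM) (by rw [← hyz.complexRoots_eq, hroots])).mpr hM⟩
      obtain ⟨g, rfl⟩ := isConj_iff.mp hyz
      rw [conj_pow, hy, mul_one, mul_inv_cancel]
    ext c
    constructor
    · obtain ⟨y, rfl⟩ := ConjClasses.exists_rep c
      intro hc
      obtain ⟨hy, hcard⟩ := hc y ConjClasses.mem_carrier_mk
      obtain ⟨M, hMn, hM, hMy⟩ := Multiset.exists_eq_add_map_conj hodd (R := y.1.1.complexRoots)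
        (by rw [card_complexRoots, Fintype.card_fin])
        (fun z => pow_eq_one_of_mem_complexRoots (SO.pow_eq_one_iff.mp hy))
        (map_conj_complexRoots _)
      have hMT : M ∈ T U := (hmem y M hMn hM hMy.symm).mp hcard
      obtain ⟨hx1, hx2⟩ := hx M hMT
      rcases SO.isConj_or_isConj hm.ne' hr hdet (hσ (x M)) hx1 hy (hx2.trans hMy) with h | h
      · exact Or.inl ⟨M, hMT, ConjClasses.mk_eq_mk_iff_isConj.mpr h⟩
      · by_cases h1 : 1 ∈ M
        · rw [← hone, ← hx2, ← SO.isConj_reflect_iff hodd hr hdet (hσ _) hx1] at h1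
          exact Or.inl ⟨M, hMT, ConjClasses.mk_eq_mk_iff_isConj.mpr (h1.trans h)⟩
        · exact Or.inr ⟨M, herase.mpr ⟨hMT, h1⟩, ConjClasses.mk_eq_mk_iff_isConj.mpr h⟩
    · rintro (⟨M, hM, rfl⟩ | ⟨M, hM, rfl⟩)
      · exact hclass _ M hM (hx M hM).1 (hx M hM).2
      · have hM' := (herase.mp hM).1
        exact hclass _ M hM' (hσpow _ (hx M hM').1) ((hσroots _).trans (hx M hM').2)
  have hT : ∀ V, (T V).Finite := fun V => Multiset.finite_setOf_card_toFinset V n s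
  rw [hset, Set.ncard_union_eq ?_ ((hT _).image _) ((hT _).image _), Set.InjOn.ncard_image,
    Set.InjOn.ncard_image,
    Multiset.ncard_setOf_card_toFinset _ _ _ hn hs, Multiset.ncard_setOf_card_toFinset _ _ _ hn hs,
    Finset.card_erase_of_mem (one_mem_upperRootsOfUnity hm), card_upperRootsOfUnity hodd]
  · obtain ⟨t, rfl⟩ : ∃ t, s = t + 1 := ⟨s - 1, by omega⟩
    simp only [Nat.add_sub_cancel, Nat.choose_succ_succ]
    ring
  · intro M hM N hN h
    have h := (ConjClasses.mk_eq_mk_iff_isConj.mp h).complexRoots_eq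
    rw [hσroots, hσroots] at h
    exact hinj (herase.mp hM).1 (herase.mp hN).1 h
  · exact fun M hM N hN h => hinj hM hN (ConjClasses.mk_eq_mk_iff_isConj.mp h).complexRoots_eq
  · rw [Set.disjoint_left]
    rintro _ ⟨M, hM, rfl⟩ ⟨N, hN, h⟩
    have h := ConjClasses.mk_eq_mk_iff_isConj.mp h
    obtain ⟨hN, hN1⟩ := herase.mp hN
    obtain rfl := hinj hN hM (by rw [← hσroots, h.complexRoots_eq])
    rw [← hone, ← (hx N hN).2, ← SO.isConj_reflect_iff hodd hr hdet (hσ _) (hx N hN).1] at hN1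
    exact hN1 h.symm
end

section
/- For any positive integer n and any even positive integer m, the number of conjugacy classes of the full orthogonal group O(2n) consisting of elements x with x^m = 1 equals C(n + m/2, m/2) + C(n + m/2 - 1, m/2). -/
open Matrix

/-- The angles `0, π / h, …, π`. -/
noncomputable def rotationAngle {h : ℕ} (k : Fin (h + 1)) : ℝ := k * Real.pi / h

/-- The `2 × 2` rotation matrix of angle `θ`. -/
noncomputable def rotationMatrix (θ : ℝ) : Matrix (Fin 2) (Fin 2) ℝ :=
  !![Real.cos θ, -Real.sin θ; Real.sin θ, Real.cos θ]

/-- The building blocks of the normal form: the reflection `diag(1, -1)` and the rotations of angle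
`k π / h`. -/
noncomputable def orthogonalBlock {h : ℕ} : Option (Fin (h + 1)) → Matrix (Fin 2) (Fin 2) ℝ
  | none => !![1, 0; 0, -1]
  | some k => rotationMatrix (rotationAngle k)

section NormalForm

variable {V : Type*} [NormedAddCommGroup V] [InnerProductSpace ℝ V]

lemma pow_apply_of_rotation {T : V →ₗ[ℝ] V} {u v : V} {θ : ℝ}
    (hu : T u = Real.cos θ • u + Real.sin θ • v)
    (hv : T v = -Real.sin θ • u + Real.cos θ • v) (j : ℕ) :
    (T ^ j) u = Real.cos (j * θ) • u + Real.sin (j * θ) • v := by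
  induction j with
  | zero => simp
  | succ j ih =>
    rw [pow_succ', Module.End.mul_apply, ih, map_add, map_smul, map_smul, hu, hv]
    push_cast
    rw [add_mul, one_mul, Real.cos_add, Real.sin_add]
    module

lemma exists_rotationAngle_eq {h : ℕ} (hh : 0 < h) {θ : ℝ} (h0 : 0 ≤ θ) (hpi : θ ≤ Real.pi)
    (hcos : Real.cos ((2 * h : ℕ) * θ) = 1) : ∃ k : Fin (h + 1), θ = rotationAngle k := by
  obtain ⟨z, hz⟩ := (Real.cos_eq_one_iff _).1 hcos
  have hh' : (0 : ℝ) < h := by exact_mod_cast hh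
  have hp := Real.pi_pos
  push_cast at hz
  have hz' : (z : ℝ) * Real.pi = h * θ := by linarith
  have hz0 : (0 : ℝ) ≤ z := by
    by_contra! hneg
    nlinarith [mul_nonneg hh'.le h0]
  have hzh : (z : ℝ) ≤ h := by
    by_contra! hlt
    nlinarith [mul_le_mul_of_nonneg_left hpi hh'.le]
  lift z to ℕ using (by exact_mod_cast hz0)
  refine ⟨⟨z, by have : z ≤ h := by exact_mod_cast hzh
                 omega⟩, ?_⟩
  rw [rotationAngle]
  field_simp
  push_cast at hz'
  linarith

/-- A line moved by a finite-order isometry `T`, and spanned by an eigenvector of `T + T*`, lies in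
a plane on which `T` is a rotation. -/
lemma exists_rotation_of_apply_apply {h : ℕ} (hh : 0 < h) {T : V →ₗ[ℝ] V}
    (hT : ∀ x y, inner ℝ (T x) (T y) = inner ℝ x y) (hpow : T ^ (2 * h) = 1)
    {e : V} (he : ‖e‖ = 1) {c : ℝ} (hc : T (T e) = (2 * c) • T e - e)
    (h1 : T e ≠ e) (h2 : T e ≠ -e) :
    ∃ (v : V) (k : Fin (h + 1)), ‖v‖ = 1 ∧ inner ℝ e v = 0 ∧
      T e = Real.cos (rotationAngle k) • e + Real.sin (rotationAngle k) • v ∧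
      T v = -Real.sin (rotationAngle k) • e + Real.cos (rotationAngle k) • v := by
  have hee : inner ℝ e e = (1 : ℝ) := by simp [he]
  have hTT : inner ℝ (T e) (T e) = (1 : ℝ) := by rw [hT, hee]
  have hcc : inner ℝ e (T e) = c := by
    have h3 : inner ℝ (T e) (T (T e)) = inner ℝ e (T e) := hT _ _
    rw [hc, inner_sub_right, inner_smul_right, hTT, real_inner_comm] at h3
    linarith
  have hcc' : inner ℝ (T e) e = c := by rw [real_inner_comm, hcc]
  have hww : inner ℝ (T e - c • e) (T e - c • e) = 1 - c ^ 2 := by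
    simp only [inner_sub_left, inner_sub_right, inner_smul_left, inner_smul_right, hTT, hee, hcc,
      hcc', RCLike.conj_to_real]
    ring
  have hpos : 0 < 1 - c ^ 2 := by
    rw [← hww]
    refine lt_of_le_of_ne real_inner_self_nonneg fun h0 => ?_
    have hw0 : T e = c • e := sub_eq_zero.1 (inner_self_eq_zero.1 h0.symm)
    have hc2 : c ^ 2 = 1 := by linarith
    rcases eq_or_eq_neg_of_sq_eq_sq c 1 (by simpa using hc2) with rfl | rfl
    · exact h1 (by simpa using hw0)
    · exact h2 (by simpa using hw0)
  have hcl : -1 ≤ c := by nlinarith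
  have hcu : c ≤ 1 := by nlinarith
  set θ := Real.arccos c with hθ
  have hcosθ : Real.cos θ = c := Real.cos_arccos hcl hcu
  have hsinθ : Real.sin θ = √(1 - c ^ 2) := Real.sin_arccos c
  have hs : 0 < Real.sin θ := by rw [hsinθ]; exact Real.sqrt_pos.2 hpos
  have hs2 : Real.sin θ ^ 2 = 1 - c ^ 2 := by rw [hsinθ, Real.sq_sqrt hpos.le]
  set s := Real.sin θ
  set v := s⁻¹ • (T e - c • e) with hv
  have hev : inner ℝ e v = 0 := by
    simp [hv, inner_smul_right, inner_sub_right, hcc, he]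
  have hvv : inner ℝ v v = 1 := by
    rw [hv, inner_smul_left, inner_smul_right, hww, ← hs2]
    simp only [RCLike.conj_to_real]
    field_simp
  have hvn : ‖v‖ = 1 := by
    rw [real_inner_self_eq_norm_sq] at hvv
    nlinarith [norm_nonneg v]
  have hTe : T e = Real.cos θ • e + s • v := by
    rw [hcosθ, hv, smul_smul, mul_inv_cancel₀ hs.ne']
    module
  have hTv : T v = -s • e + Real.cos θ • v := by
    have : T v = s⁻¹ • ((c ^ 2 - 1) • e + (c * s) • v) := by
      rw [hv, map_smul, map_sub, map_smul, hc, ← hv, hTe, hcosθ]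
      module
    rw [this, show c ^ 2 - 1 = -s ^ 2 by linarith, hcosθ, smul_add, smul_smul, smul_smul]
    congr 2 <;> field_simp
  have hcos : Real.cos ((2 * h : ℕ) * θ) = 1 := by
    have h3 := pow_apply_of_rotation hTe hTv (2 * h)
    rw [hpow, Module.End.one_apply] at h3
    have h4 := congrArg (inner ℝ e) h3
    rw [inner_add_right, inner_smul_right, inner_smul_right, hev, hee] at h4
    linarith
  obtain ⟨k, hk⟩ := exists_rotationAngle_eq hh (Real.arccos_nonneg c) (Real.arccos_le_pi c) hcos
  rw [← hθ] at hk
  exact ⟨v, k, hvn, hev, hk ▸ hTe, hk ▸ hTv⟩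

lemma inner_apply_eq_zero_of_orthogonalBlock {h : ℕ} {T : V →ₗ[ℝ] V}
    (hT : ∀ x y, inner ℝ (T x) (T y) = inner ℝ x y) {o : Option (Fin (h + 1))} {e : Fin 2 → V}
    (he : ∀ a, T (e a) = ∑ b, orthogonalBlock o b a • e b) {w : V} (hw : ∀ a, inner ℝ (e a) w = 0)
    (a : Fin 2) : inner ℝ (e a) (T w) = 0 := by
  have hTw : ∀ b, inner ℝ (T (e b)) (T w) = 0 := fun b => by rw [hT, hw]
  have : e a = ∑ b, orthogonalBlock o a b • T (e b) := by
    rcases o with _ | k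
    · fin_cases a <;> simp [he, orthogonalBlock]
    · have hcs := Real.cos_sq_add_sin_sq (rotationAngle k)
      fin_cases a <;>
        simp only [he, orthogonalBlock, rotationMatrix, Fin.sum_univ_two, of_apply, cons_val',
          cons_val_zero, cons_val_one, Fin.zero_eta, Fin.mk_one, cons_val_fin_one,
          Fin.isValue]
      · have hcs' := congrArg (· • e 0) hcs
        simp only [one_smul] at hcs'
        nth_rewrite 1 [← hcs']
        module
      · have hcs' := congrArg (· • e 1) hcs
        simp only [one_smul] at hcs'
        nth_rewrite 1 [← hcs']
        module
  rw [this, sum_inner]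
  simp [inner_smul_left, hTw]

variable [FiniteDimensional ℝ V]

/-- A finite-order isometry of a space of dimension at least `2` acts on some plane through one of
the building blocks, and this block may be taken to be a rotation unless the space is a plane. -/
lemma exists_orthogonalBlock_plane {h n : ℕ} (hh : 0 < h) {T : V →ₗ[ℝ] V}
    (hT : ∀ x y, inner ℝ (T x) (T y) = inner ℝ x y) (hpow : T ^ (2 * h) = 1)
    (hV : Module.finrank ℝ V = 2 * (n + 1)) :
    ∃ (o : Option (Fin (h + 1))) (e : Fin 2 → V), (o = none → n = 0) ∧ Orthonormal ℝ e ∧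
      ∀ a, T (e a) = ∑ b, orthogonalBlock o b a • e b := by
  have hh0 : (h : ℝ) ≠ 0 := by exact_mod_cast hh.ne'
  have hadj : ∀ x, T (LinearMap.adjoint T x) = x := by
    have h1 : LinearMap.adjoint T * T = 1 := by
      ext x
      refine ext_inner_left ℝ fun y => ?_
      simp [LinearMap.adjoint_inner_right, hT]
    intro x
    exact congrArg (fun f : V →ₗ[ℝ] V => f x) (mul_eq_one_comm.1 h1)
  have hS : (T + LinearMap.adjoint T).IsSymmetric := by
    intro x y
    simp [inner_add_left, inner_add_right, LinearMap.adjoint_inner_left,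
      LinearMap.adjoint_inner_right, add_comm]
  set B := hS.eigenvectorBasis hV
  by_cases hall : ∀ i, T (B i) = B i ∨ T (B i) = -B i
  · have plane : ∀ (o : Option (Fin (h + 1))) (i j : Fin (2 * (n + 1))), (o = none → n = 0) →
        i ≠ j → (∀ a, T (![B i, B j] a) = ∑ b, orthogonalBlock o b a • ![B i, B j] b) →
        ∃ (o : Option (Fin (h + 1))) (e : Fin 2 → V), (o = none → n = 0) ∧ Orthonormal ℝ e ∧
          ∀ a, T (e a) = ∑ b, orthogonalBlock o b a • e b := fun o i j ho hij hT => by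
      refine ⟨o, ![B i, B j], ho, ?_, hT⟩
      have := B.orthonormal.comp ![i, j] (by
        intro a b; fin_cases a <;> fin_cases b <;> simp [hij, hij.symm])
      convert this using 1
      ext a; fin_cases a <;> rfl
    have hpos := fun i j (hij : i ≠ j) (hi : T (B i) = B i) (hj : T (B j) = B j) =>
      plane (some 0) i j (by simp) hij
        (by simp [orthogonalBlock, rotationMatrix, rotationAngle, hi, hj])
    have hneg := fun i j (hij : i ≠ j) (hi : T (B i) = -B i) (hj : T (B j) = -B j) =>
      plane (some (Fin.last h)) i j (by simp) hij
        (by simp [orthogonalBlock, rotationMatrix, rotationAngle, hi, hj, hh0])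
    have hmix := fun hn i j (hij : i ≠ j) (hi : T (B i) = B i) (hj : T (B j) = -B j) =>
      plane none i j (fun _ => hn) hij (by simp [orthogonalBlock, hi, hj])
    let i0 : Fin (2 * (n + 1)) := ⟨0, by omega⟩
    let i1 : Fin (2 * (n + 1)) := ⟨1, by omega⟩
    have h01 : i0 ≠ i1 := by simp [i0, i1]
    rcases Nat.eq_zero_or_pos n with hn | hn
    · rcases hall i0 with h0 | h0 <;> rcases hall i1 with h1 | h1
      · exact hpos _ _ h01 h0 h1
      · exact hmix hn _ _ h01 h0 h1
      · exact hmix hn _ _ h01.symm h1 h0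
      · exact hneg _ _ h01 h0 h1
    · let i2 : Fin (2 * (n + 1)) := ⟨2, by omega⟩
      have h02 : i0 ≠ i2 := by simp [i0, i2]
      have h12 : i1 ≠ i2 := by simp [i1, i2]
      rcases hall i0 with h0 | h0 <;> rcases hall i1 with h1 | h1
      · exact hpos _ _ h01 h0 h1
      · rcases hall i2 with h2 | h2
        · exact hpos _ _ h02 h0 h2
        · exact hneg _ _ h12 h1 h2
      · rcases hall i2 with h2 | h2
        · exact hpos _ _ h12 h1 h2
        · exact hneg _ _ h02 h0 h2
      · exact hneg _ _ h01 h0 h1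
  · push Not at hall
    obtain ⟨i, hi1, hi2⟩ := hall
    have he : ‖B i‖ = 1 := B.orthonormal.1 i
    have hev := congrArg T (hS.apply_eigenvectorBasis hV i)
    rw [LinearMap.add_apply, map_add, hadj, map_smul] at hev
    obtain ⟨v, k, hv, hBv, hTB, hTv⟩ := exists_rotation_of_apply_apply hh hT hpow he
      (c := hS.eigenvalues hV i / 2) (by
        rw [mul_div_cancel₀ _ two_ne_zero]; exact eq_sub_of_add_eq hev) hi1 hi2
    refine ⟨some k, ![B i, v], by simp, ?_, ?_⟩
    · rw [orthonormal_iff_ite]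
      intro a b
      fin_cases a <;> fin_cases b <;> simp [he, hv, hBv, real_inner_comm (B i) v]
    · intro a
      fin_cases a
      · simpa [orthogonalBlock, rotationMatrix] using hTB
      · simpa [orthogonalBlock, rotationMatrix] using hTv

/-- Normal form of finite-order isometries of an even-dimensional Euclidean space. -/
theorem exists_orthogonalBlock_normalForm {h : ℕ} (hh : 0 < h) (n : ℕ) {V : Type*}
    [NormedAddCommGroup V] [InnerProductSpace ℝ V] [FiniteDimensional ℝ V] {T : V →ₗ[ℝ] V}
    (hT : ∀ x y, inner ℝ (T x) (T y) = inner ℝ x y) (hpow : T ^ (2 * h) = 1)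
    (hV : Module.finrank ℝ V = 2 * n) :
    ∃ (f : Fin n → Option (Fin (h + 1))) (e : Fin 2 × Fin n → V),
      (∀ i j, f i = none → f j = none → i = j) ∧ Orthonormal ℝ e ∧
      ∀ a j, T (e (a, j)) = ∑ b, orthogonalBlock (f j) b a • e (b, j) := by
  induction n generalizing V with
  | zero => exact ⟨finZeroElim, fun x => x.2.elim0, finZeroElim,
      ⟨fun x => x.2.elim0, fun x => x.2.elim0⟩, fun _ => finZeroElim⟩
  | succ n ih =>
    obtain ⟨o, e, ho, heo, heT⟩ := exists_orthogonalBlock_plane hh hT hpow hV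
    set K := Submodule.span ℝ (Set.range e)
    have hmem : ∀ w, w ∈ Kᗮ ↔ ∀ a, inner ℝ (e a) w = 0 := by
      intro w
      rw [Submodule.mem_orthogonal]
      refine ⟨fun H a => H _ (Submodule.subset_span ⟨a, rfl⟩), fun H u hu => ?_⟩
      induction hu using Submodule.span_induction with
      | mem x hx => obtain ⟨a, rfl⟩ := hx; exact H a
      | zero => simp
      | add x y _ _ hx hy => rw [inner_add_left, hx, hy, add_zero]
      | smul r x _ hx => rw [inner_smul_left, hx, mul_zero]
    have hinv : ∀ w ∈ Kᗮ, T w ∈ Kᗮ := fun w hw =>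
      (hmem _).2 (inner_apply_eq_zero_of_orthogonalBlock hT heT ((hmem w).1 hw))
    have hK : Module.finrank ℝ K = 2 := by
      simpa using finrank_span_eq_card heo.linearIndependent
    have hKo : Module.finrank ℝ Kᗮ = 2 * n := by
      have := Submodule.finrank_add_finrank_orthogonal K
      omega
    obtain ⟨f, e', hf, heo', heT'⟩ := ih (V := Kᗮ) (T := T.restrict hinv)
      (fun x y => hT x y) (by
        rw [Module.End.pow_restrict (2 * h) hinv]
        ext x
        simp [hpow]) hKo
    refine ⟨Fin.cons o f,
      fun x => (Fin.cons (e x.1) (fun j => (e' (x.1, j) : V)) : Fin (n + 1) → V) x.2, ?_, ?_, ?_⟩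
    · intro i j hi hj
      by_cases hn : n = 0
      · exact Fin.ext (by omega)
      · have ho' : o ≠ none := fun H => hn (ho H)
        cases i using Fin.cases with
        | zero => exact absurd hi ho'
        | succ i =>
          cases j using Fin.cases with
          | zero => exact absurd hj ho'
          | succ j => exact congrArg _ (hf i j hi hj)
    · rw [orthonormal_iff_ite] at heo heo' ⊢
      have hperp : ∀ a x, inner ℝ (e a) (e' x : V) = 0 := fun a x => (hmem _).1 (e' x).2 a
      rintro ⟨a, i⟩ ⟨b, j⟩
      cases i using Fin.cases with
      | zero =>
        cases j using Fin.cases with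
        | zero => simp [heo]
        | succ j => simp [hperp, (Fin.succ_ne_zero j).symm]
      | succ i =>
        cases j using Fin.cases with
        | zero => simp [real_inner_comm (e b), hperp, Fin.succ_ne_zero i]
        | succ j => simpa using heo' (a, i) (b, j)
    · intro a j
      cases j using Fin.cases with
      | zero => simpa using heT a
      | succ j => simpa using congrArg (Subtype.val : Kᗮ → V) (heT' a j)

end NormalForm

/-- The block-diagonal matrix with prescribed building blocks. -/
noncomputable def blockMatrix {h n : ℕ} (f : Fin n → Option (Fin (h + 1))) :
    Matrix (Fin (2 * n)) (Fin (2 * n)) ℝ :=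
  reindexAlgEquiv ℝ ℝ finProdFinEquiv (blockDiagonal fun j => orthogonalBlock (f j))

lemma rotationMatrix_pow (θ : ℝ) (j : ℕ) : rotationMatrix θ ^ j = rotationMatrix (j * θ) := by
  induction j with
  | zero => simp [rotationMatrix, one_fin_two]
  | succ j ih =>
    rw [pow_succ, ih]
    ext a b
    fin_cases a <;> fin_cases b <;>
      simp [rotationMatrix, mul_apply, add_mul, Real.cos_add, Real.sin_add] <;> ring

lemma orthogonalBlock_pow {h : ℕ} (hh : 0 < h) (o : Option (Fin (h + 1))) :
    orthogonalBlock o ^ (2 * h) = 1 := by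
  rcases o with _ | k
  · have : (orthogonalBlock (none : Option (Fin (h + 1)))) ^ 2 = 1 := by
      simp [orthogonalBlock, sq, one_fin_two]
    rw [pow_mul, this, one_pow]
  · have hh0 : (h : ℝ) ≠ 0 := by exact_mod_cast hh.ne'
    have : ((2 * h : ℕ) : ℝ) * rotationAngle k = (k : ℕ) * (2 * Real.pi) := by
      rw [rotationAngle]; push_cast; field_simp
    rw [orthogonalBlock, rotationMatrix_pow, this, rotationMatrix]
    have hs : Real.sin ((k : ℕ) * (2 * Real.pi)) = 0 := by
      simpa using Real.sin_add_nat_mul_two_pi 0 k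
    simp [hs, one_fin_two]

lemma orthogonalBlock_mul_transpose {h : ℕ} (o : Option (Fin (h + 1))) :
    orthogonalBlock o * (orthogonalBlock o)ᵀ = 1 := by
  rcases o with _ | k
  · ext a b
    fin_cases a <;> fin_cases b <;> simp [orthogonalBlock, mul_apply]
  · have hcs := Real.cos_sq_add_sin_sq (rotationAngle k)
    ext a b
    fin_cases a <;> fin_cases b <;> simp [orthogonalBlock, rotationMatrix, mul_apply] <;>
      linarith

section BlockMatrix

variable {h n : ℕ}

lemma blockMatrix_pow (hh : 0 < h) (f : Fin n → Option (Fin (h + 1))) :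
    blockMatrix f ^ (2 * h) = 1 := by
  rw [blockMatrix, ← map_pow, ← blockDiagonal_pow]
  have : (fun j => orthogonalBlock (f j)) ^ (2 * h) = 1 := by
    funext j
    exact orthogonalBlock_pow hh (f j)
  rw [this, blockDiagonal_one, map_one]

lemma blockMatrix_mem_orthogonalGroup (f : Fin n → Option (Fin (h + 1))) :
    blockMatrix f ∈ orthogonalGroup (Fin (2 * n)) ℝ := by
  rw [mem_orthogonalGroup_iff]
  have : (blockMatrix f)ᵀ =
      reindexAlgEquiv ℝ ℝ finProdFinEquiv (blockDiagonal fun j => (orthogonalBlock (f j))ᵀ) := by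
    rw [← blockDiagonal_transpose]; rfl
  rw [this, blockMatrix, ← map_mul, ← blockDiagonal_mul]
  simp_rw [orthogonalBlock_mul_transpose]
  exact (congrArg _ blockDiagonal_one).trans (map_one _)

/-- The conjugacy class of a block-diagonal matrix. -/
noncomputable def blockClass (f : Fin n → Option (Fin (h + 1))) :
    ConjClasses (orthogonalGroup (Fin (2 * n)) ℝ) :=
  ConjClasses.mk ⟨blockMatrix f, blockMatrix_mem_orthogonalGroup f⟩

lemma conjClasses_mk_eq_of_mul_eq {N : ℕ} {A B : orthogonalGroup (Fin N) ℝ}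
    {U : Matrix (Fin N) (Fin N) ℝ} (hU : U ∈ orthogonalGroup (Fin N) ℝ)
    (hAB : U * A.1 = B.1 * U) : ConjClasses.mk A = ConjClasses.mk B := by
  rw [ConjClasses.mk_eq_mk_iff_isConj, isConj_iff]
  exact ⟨⟨U, hU⟩, mul_inv_eq_of_eq_mul (Subtype.ext hAB)⟩

lemma blockClass_comp_perm (f : Fin n → Option (Fin (h + 1))) (σ : Equiv.Perm (Fin n)) :
    blockClass (f ∘ σ) = blockClass f := by
  set τ : Equiv.Perm (Fin (2 * n)) :=
    (finProdFinEquiv.symm.trans (Equiv.prodCongr (Equiv.refl _) σ)).trans finProdFinEquiv with hτ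
  have hf : blockMatrix (f ∘ σ) = (blockMatrix f).submatrix τ τ := by
    ext x y
    simp [blockMatrix, hτ, blockDiagonal_apply]
  symm
  refine conjClasses_mk_eq_of_mul_eq (U := τ.toPEquiv.toMatrix) ?_ ?_
  · rw [mem_orthogonalGroup_iff, ← PEquiv.toMatrix_symm, PEquiv.toMatrix_toPEquiv_mul,
      ← Equiv.toPEquiv_symm]
    ext x y
    simp [PEquiv.toMatrix_apply, one_apply]
  · change _ = blockMatrix (f ∘ σ) * _
    rw [hf, PEquiv.toMatrix_toPEquiv_mul, PEquiv.mul_toMatrix_toPEquiv, submatrix_submatrix]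
    congr 1
    funext x
    simp

/-- Every finite-order orthogonal matrix is conjugate to a block-diagonal one. -/
theorem exists_blockClass_eq (hh : 0 < h) (A : orthogonalGroup (Fin (2 * n)) ℝ)
    (hA : A ^ (2 * h) = 1) :
    ∃ f : Fin n → Option (Fin (h + 1)),
      (∀ i j, f i = none → f j = none → i = j) ∧ blockClass f = ConjClasses.mk A := by
  have hA' : A.1ᵀ * A.1 = 1 := (mem_orthogonalGroup_iff' _ _).1 A.2
  have hApow : A.1 ^ (2 * h) = 1 := congrArg Subtype.val hA
  have hpow : toEuclideanLin A.1 ^ (2 * h) = 1 := by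
    rw [toEuclideanLin, ← toLpLin_pow, hApow, toLpLin_one]
    rfl
  obtain ⟨f, e, hf, he, hTe⟩ := exists_orthogonalBlock_normalForm hh n
    (T := toEuclideanLin A.1) (fun x y => by
      simp only [EuclideanSpace.inner_eq_star_dotProduct, ofLp_toLpLin, toLin'_apply, star_trivial]
      rw [dotProduct_mulVec, vecMul_mulVec, hA', vecMul_one]) hpow (by simp)
  refine ⟨f, hf, ?_⟩
  refine conjClasses_mk_eq_of_mul_eq (U := of fun i x => e (finProdFinEquiv.symm x) i) ?_ ?_
  · rw [mem_orthogonalGroup_iff']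
    ext x y
    have := orthonormal_iff_ite.1 he (finProdFinEquiv.symm x) (finProdFinEquiv.symm y)
    simp only [EuclideanSpace.inner_eq_star_dotProduct, star_trivial,
      EmbeddingLike.apply_eq_iff_eq] at this
    rw [one_apply, ← this, dotProduct_comm]
    rfl
  · ext i x
    obtain ⟨⟨a, j⟩, rfl⟩ := finProdFinEquiv.surjective x
    have := congrArg (fun v => v.ofLp i) (hTe a j)
    simp only [ofLp_toLpLin, toLin'_apply] at this
    simp only [mul_apply, of_apply, Equiv.symm_apply_apply]
    change _ = (A.1 *ᵥ (e (a, j)).ofLp) i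
    rw [this, ← finProdFinEquiv.sum_comp, Fintype.sum_prod_type]
    simp [blockMatrix, blockDiagonal_apply, mul_comm]

/-- A finite sequence is determined up to permutation by its multiset of values. -/
lemma exists_perm_of_map_univ_eq {ι α : Type*} [Fintype ι] {f g : ι → α}
    (hfg : Finset.univ.val.map f = Finset.univ.val.map g) : ∃ σ : Equiv.Perm ι, g ∘ σ = f := by
  classical
  have H : ∀ x, Nonempty ({i // f i = x} ≃ {i // g i = x}) := fun x => by
    rw [← Fintype.card_eq, Fintype.card_subtype, Fintype.card_subtype]
    have := congrArg (Multiset.count x) hfg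
    rw [Multiset.count_map, Multiset.count_map] at this
    simpa [eq_comm, Finset.card, Finset.filter] using this
  refine ⟨((Equiv.sigmaFiberEquiv f).symm.trans (Equiv.sigmaCongrRight fun x => (H x).some)).trans
    (Equiv.sigmaFiberEquiv g), ?_⟩
  funext i
  exact ((H (f i)).some ⟨i, rfl⟩).2

end BlockMatrix

section Counting

variable {h n : ℕ}

/-- The indices of the angles whose doubled cosines are the diagonal entries of the sum of a
building block and its transpose. -/
def blockAngles : Option (Fin (h + 1)) → Fin 2 → Fin (h + 1)
  | none => ![0, Fin.last h]
  | some k => ![k, k]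

lemma orthogonalBlock_add_transpose (hh : 0 < h) (o : Option (Fin (h + 1))) :
    orthogonalBlock o + (orthogonalBlock o)ᵀ =
      diagonal fun a => 2 * Real.cos (rotationAngle (blockAngles o a)) := by
  have hh0 : (h : ℝ) ≠ 0 := by exact_mod_cast hh.ne'
  rcases o with _ | k <;> ext a b <;> fin_cases a <;> fin_cases b <;>
    simp [orthogonalBlock, rotationMatrix, blockAngles, rotationAngle, hh0] <;> ring

lemma injective_two_mul_cos_rotationAngle (hh : 0 < h) :
    Function.Injective fun k : Fin (h + 1) => 2 * Real.cos (rotationAngle k) := by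
  intro k l hkl
  have hh0 : (0 : ℝ) < h := by exact_mod_cast hh
  have hmem : ∀ k : Fin (h + 1), rotationAngle k ∈ Set.Icc 0 Real.pi := fun k => by
    have hk : ((k : ℕ) : ℝ) ≤ h := by exact_mod_cast Nat.lt_succ_iff.1 k.2
    have hp := Real.pi_pos
    refine ⟨by rw [rotationAngle]; positivity, ?_⟩
    rw [rotationAngle, div_le_iff₀ hh0]
    nlinarith
  have := Real.injOn_cos (hmem k) (hmem l) (by simpa using hkl)
  rw [rotationAngle, rotationAngle, div_left_inj' hh0.ne', mul_left_inj' Real.pi_ne_zero] at this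
  exact Fin.ext (by exact_mod_cast this)

lemma roots_charpoly_blockMatrix_add_transpose (hh : 0 < h) (f : Fin n → Option (Fin (h + 1))) :
    (blockMatrix f + (blockMatrix f)ᵀ).charpoly.roots =
      ((Finset.univ.val.map f).bind fun o => Finset.univ.val.map (blockAngles o)).map
        fun k => 2 * Real.cos (rotationAngle k) := by
  have : blockMatrix f + (blockMatrix f)ᵀ = reindexAlgEquiv ℝ ℝ finProdFinEquiv
      (diagonal fun x => 2 * Real.cos (rotationAngle (blockAngles (f x.2) x.1))) := by
    have htr : (blockMatrix f)ᵀ = reindexAlgEquiv ℝ ℝ finProdFinEquiv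
        (blockDiagonal fun j => (orthogonalBlock (f j))ᵀ) := by
      rw [← blockDiagonal_transpose]; rfl
    rw [htr, blockMatrix, ← map_add, ← blockDiagonal_add]
    refine congrArg _ (Eq.trans (congrArg _ ?_) (blockDiagonal_diagonal
      fun j a => 2 * Real.cos (rotationAngle (blockAngles (f j) a))))
    funext j
    exact orthogonalBlock_add_transpose hh (f j)
  rw [this, coe_reindexAlgEquiv, charpoly_reindex, charpoly_diagonal,
    Polynomial.roots_prod _ _ (Finset.prod_ne_zero_iff.2 fun _ _ => Polynomial.X_sub_C_ne_zero _)]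
  simp only [Polynomial.roots_X_sub_C, Multiset.bind_singleton, Multiset.map_bind,
    Multiset.map_map, Multiset.bind_map]
  rw [← Finset.univ_product_univ, Finset.product_val]
  refine Eq.trans ?_ (Multiset.bind_map_comm (Finset.univ : Finset (Fin 2)).val _)
  simp only [SProd.sprod, Multiset.product, Multiset.map_bind, Multiset.map_map,
    Function.comp_apply]

lemma blockAngles_eq_of_blockClass_eq (hh : 0 < h) {f g : Fin n → Option (Fin (h + 1))}
    (hfg : blockClass f = blockClass g) :
    ((Finset.univ.val.map f).bind fun o => Finset.univ.val.map (blockAngles o)) =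
      (Finset.univ.val.map g).bind fun o => Finset.univ.val.map (blockAngles o) := by
  refine Multiset.map_injective (injective_two_mul_cos_rotationAngle hh) ?_
  rw [← roots_charpoly_blockMatrix_add_transpose hh, ← roots_charpoly_blockMatrix_add_transpose hh]
  rw [blockClass, blockClass, ConjClasses.mk_eq_mk_iff_isConj, isConj_iff] at hfg
  obtain ⟨U, hU⟩ := hfg
  have hU' : U.1 * blockMatrix f * U.1ᵀ = blockMatrix g := congrArg Subtype.val hU
  have hUU : U.1ᵀ * U.1 = 1 := (mem_orthogonalGroup_iff' _ _).1 U.2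
  have : blockMatrix g + (blockMatrix g)ᵀ = U.1 * (blockMatrix f + (blockMatrix f)ᵀ) * U.1ᵀ := by
    rw [← hU']
    simp only [transpose_mul, transpose_transpose, mul_add, add_mul, mul_assoc]
  rw [this, charpoly_mul_comm, ← mul_assoc, hUU, one_mul]

/-- The multiset of building blocks with prescribed rotations, completed by one reflection if there
is room for it. -/
def blockMultiset : Sym (Fin (h + 1)) (n + 1) ⊕ Sym (Fin (h + 1)) n →
    Multiset (Option (Fin (h + 1)))
  | .inl s => (s : Multiset (Fin (h + 1))).map some
  | .inr s => none ::ₘ (s : Multiset (Fin (h + 1))).map some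

lemma card_blockMultiset (x : Sym (Fin (h + 1)) (n + 1) ⊕ Sym (Fin (h + 1)) n) :
    (blockMultiset x).card = n + 1 := by
  rcases x with s | s <;> simp [blockMultiset]

lemma bind_some_blockAngles (s : Multiset (Fin (h + 1))) :
    ((s.map some).bind fun o => Finset.univ.val.map (blockAngles o)) = s + s := by
  rw [Multiset.bind_map]
  have : ∀ k : Fin (h + 1), Finset.univ.val.map (blockAngles (some k)) = {k} + {k} := fun k => rfl
  rw [Multiset.bind_congr fun k _ => this k, Multiset.bind_add,
    Multiset.bind_singleton (f := fun k => k), Multiset.map_id']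

lemma injective_blockMultiset_bind (hh : 0 < h) :
    Function.Injective fun x : Sym (Fin (h + 1)) (n + 1) ⊕ Sym (Fin (h + 1)) n =>
      (blockMultiset x).bind fun o => Finset.univ.val.map (blockAngles o) := by
  have hnone : Finset.univ.val.map (blockAngles (none : Option (Fin (h + 1)))) =
      {0} + {Fin.last h} := rfl
  have h0 : Fin.last h ≠ 0 := by simp [Fin.ext_iff, hh.ne']
  have hinj : ∀ s t : Multiset (Fin (h + 1)), s + s = t + t → s = t := fun s t hst => by
    ext k
    have := congrArg (Multiset.count k) hst
    simp only [Multiset.count_add] at this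
    omega
  have hne : ∀ s t : Multiset (Fin (h + 1)), s + s ≠ ({0} + {Fin.last h}) + (t + t) :=
    fun s t hst => by
      have := congrArg (Multiset.count 0) hst
      simp [h0.symm] at this
      omega
  rintro (s | s) (t | t) hst <;>
    simp only [blockMultiset, Multiset.cons_bind, bind_some_blockAngles, hnone] at hst
  · exact congrArg _ (Sym.coe_injective (hinj _ _ hst))
  · exact absurd hst (hne _ _)
  · exact absurd hst.symm (hne _ _)
  · exact congrArg _ (Sym.coe_injective (hinj _ _ (add_left_cancel hst)))

lemma exists_blockMultiset_eq {f : Fin (n + 1) → Option (Fin (h + 1))}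
    (hf : ∀ i j, f i = none → f j = none → i = j) :
    ∃ x : Sym (Fin (h + 1)) (n + 1) ⊕ Sym (Fin (h + 1)) n,
      blockMultiset x = Finset.univ.val.map f := by
  have hlift : ∀ s : Multiset (Option (Fin (h + 1))), none ∉ s →
      ∃ t : Multiset (Fin (h + 1)), t.map some = s := fun s hs => by
    induction s using Multiset.induction with
    | empty => exact ⟨0, rfl⟩
    | cons o s ih =>
      rw [Multiset.mem_cons, not_or] at hs
      obtain ⟨t, rfl⟩ := ih hs.2
      obtain ⟨k, rfl⟩ := Option.ne_none_iff_exists'.1 (Ne.symm hs.1)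
      exact ⟨k ::ₘ t, Multiset.map_cons _ _ _⟩
  by_cases hnone : ∃ i, f i = none
  · obtain ⟨i, hi⟩ := hnone
    obtain ⟨t, ht⟩ := hlift (((Finset.univ.erase i).val).map f) (by
      simp only [Multiset.mem_map, Finset.mem_val, Finset.mem_erase, not_exists, not_and]
      exact fun j hj hj' => hj.1 (hf j i hj' hi))
    refine ⟨.inr ⟨t, ?_⟩, ?_⟩
    · simpa using congrArg Multiset.card ht
    · change none ::ₘ t.map some = _
      rw [ht, ← hi, ← Multiset.map_cons, Finset.erase_val,
        Multiset.cons_erase (Finset.mem_univ i)]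
  · push Not at hnone
    obtain ⟨t, ht⟩ := hlift (Finset.univ.val.map f) (by
      simpa only [Multiset.mem_map, not_exists, not_and] using fun i _ => hnone i)
    refine ⟨.inl ⟨t, ?_⟩, ht⟩
    simpa using congrArg Multiset.card ht

lemma exists_map_univ_eq {α : Type*} {s : Multiset α} (hs : s.card = n) :
    ∃ f : Fin n → α, Finset.univ.val.map f = s := by
  subst hs
  induction s using Quotient.inductionOn with
  | h l => exact ⟨l.get, (Fin.univ_val_map _).trans (congrArg _ (List.ofFn_get l))⟩

end Counting

/-- For any positive integer `n` and even positive integer `m`, the number of conjugacy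
classes of the full orthogonal group `O(2n)` consisting of elements `x` with `x ^ m = 1`
equals `C(n + m/2, m/2) + C(n + m/2 - 1, m/2)`. -/
theorem stmt_18 (n m : ℕ) (hn : 0 < n) (hm : 0 < m) (heven : Even m) :
    {c : ConjClasses (Matrix.orthogonalGroup (Fin (2 * n)) ℝ) |
        ∀ x ∈ c.carrier, x ^ m = 1}.ncard
      = Nat.choose (n + m / 2) (m / 2) + Nat.choose (n + m / 2 - 1) (m / 2) := by
  obtain ⟨h, rfl⟩ := heven.two_dvd
  obtain ⟨n, rfl⟩ := Nat.exists_eq_succ_of_ne_zero hn.ne'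
  have hh : 0 < h := by omega
  rw [Nat.mul_div_cancel_left h two_pos]
  choose r hr using fun x : Sym (Fin (h + 1)) (n + 1) ⊕ Sym (Fin (h + 1)) n =>
    exists_map_univ_eq (card_blockMultiset x)
  have hinj : Function.Injective fun x => blockClass (r x) := fun x y hxy =>
    injective_blockMultiset_bind hh (by
      simpa only [hr] using blockAngles_eq_of_blockClass_eq hh hxy)
  have hrange : {c : ConjClasses (orthogonalGroup (Fin (2 * (n + 1))) ℝ) |
      ∀ x ∈ c.carrier, x ^ (2 * h) = 1} = Set.range fun x => blockClass (r x) := by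
    ext c
    constructor
    · intro hc
      obtain ⟨A, rfl⟩ := ConjClasses.exists_rep c
      obtain ⟨f, hf, hfA⟩ := exists_blockClass_eq hh A (hc A ConjClasses.mem_carrier_mk)
      obtain ⟨x, hx⟩ := exists_blockMultiset_eq hf
      obtain ⟨σ, hσ⟩ := exists_perm_of_map_univ_eq ((hr x).trans hx)
      exact ⟨x, by simp only [← hfA, ← hσ, blockClass_comp_perm]⟩
    · rintro ⟨x, rfl⟩ A hA
      obtain ⟨U, rfl⟩ := isConj_iff.1
        (ConjClasses.mk_eq_mk_iff_isConj.1 (ConjClasses.mem_carrier_iff_mk_eq.1 hA)).symm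
      rw [conj_pow, Subtype.ext (a1 := (⟨blockMatrix (r x),
        blockMatrix_mem_orthogonalGroup (r x)⟩ : orthogonalGroup _ ℝ) ^ (2 * h)) (a2 := 1)
        (blockMatrix_pow hh (r x))]
      simp
  rw [hrange, Set.ncard_range_of_injective hinj, Nat.card_sum, Sym.natCard_sym_eq_choose,
    Sym.natCard_sym_eq_choose, Nat.card_fin]
  congr 1
  · rw [← Nat.choose_symm_of_eq_add (a := h) (b := n + 1) (by omega)]
    congr 1
    omega
  · rw [← Nat.choose_symm_of_eq_add (a := h) (b := n) (by omega)]
    congr 1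
    omega
end
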